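/- Let M be a II₁ factor with faithful tracial state τ, let A ⊆ M be a MASA, and set N := N_M(A)''. Assume the τ-preserving conditional expectations E_A and E_N exist. For a unitary u ∈ M define E_{uAu*}(x) := u E_A(u* x u) u* and ‖E_{uAu*} − E_A‖_{∞,2} := sup{‖E_{uAu*}(x) − E_A(x)‖₂ : x ∈ M, ‖x‖ ≤ 1}, where ‖x‖ is the operator norm. Then for every unitary u ∈ M one has ‖E_{uAu*} − E_A‖_{∞,2} ≥ ‖u − E_N(u)‖₂ (a generalization of the Sinclair–Smith strong singularity inequality). -/

import Mathlib

open scoped ComplexOrder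

noncomputable section

variable {H : Type*} [NormedAddCommGroup H] [InnerProductSpace ℂ H] [CompleteSpace H]

/-- The von Neumann algebra generated by a set of bounded operators `S`:
the double commutant of `S ∪ S*`. -/
def vNgen (S : Set (H →L[ℂ] H)) : Set (H →L[ℂ] H) :=
  Set.centralizer (Set.centralizer (S ∪ star '' S))

/-- `M` is a von Neumann algebra acting on `H`: a unital *-subalgebra of `B(H)`
equal to its double commutant. -/
structure IsVonNeumannAlgebra (M : Set (H →L[ℂ] H)) : Prop where
  one_mem : (1 : H →L[ℂ] H) ∈ M
  add_mem : ∀ x ∈ M, ∀ y ∈ M, x + y ∈ M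
  mul_mem : ∀ x ∈ M, ∀ y ∈ M, x * y ∈ M
  smul_mem : ∀ (c : ℂ), ∀ x ∈ M, c • x ∈ M
  star_mem : ∀ x ∈ M, star x ∈ M
  double_commutant : Set.centralizer (Set.centralizer M) = M

/-- `τ` is a faithful tracial state on `M`. -/
structure IsFaithfulTracialState (M : Set (H →L[ℂ] H)) (τ : (H →L[ℂ] H) → ℂ) : Prop where
  map_add : ∀ x ∈ M, ∀ y ∈ M, τ (x + y) = τ x + τ y
  map_smul : ∀ (c : ℂ), ∀ x ∈ M, τ (c • x) = c * τ x
  map_one : τ 1 = 1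
  nonneg : ∀ x ∈ M, 0 ≤ τ (star x * x)
  tracial : ∀ x ∈ M, ∀ y ∈ M, τ (x * y) = τ (y * x)
  faithful : ∀ x ∈ M, τ (star x * x) = 0 → x = 0

/-- `M` is infinite dimensional: it is not contained in the span of finitely many operators. -/
def IsInfiniteDimensionalSet (M : Set (H →L[ℂ] H)) : Prop :=
  ∀ s : Finset (H →L[ℂ] H),
    ¬ (M ⊆ (Submodule.span ℂ (s : Set (H →L[ℂ] H)) : Set (H →L[ℂ] H)))

/-- `M` is a factor: its center consists of scalar multiples of the identity. -/
def IsFactor (M : Set (H →L[ℂ] H)) : Prop :=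
  ∀ x ∈ M, (∀ y ∈ M, x * y = y * x) → ∃ c : ℂ, x = c • (1 : H →L[ℂ] H)

/-- `M` is a II₁ factor with faithful tracial state `τ`. -/
structure IsII1Factor (M : Set (H →L[ℂ] H)) (τ : (H →L[ℂ] H) → ℂ) : Prop where
  vna : IsVonNeumannAlgebra M
  factor : IsFactor M
  infdim : IsInfiniteDimensionalSet M
  trace : IsFaithfulTracialState M τ

/-- The 2-norm `‖x‖₂ = τ(x*x)^{1/2}` associated to the trace `τ`. -/
def norm2 (τ : (H →L[ℂ] H) → ℂ) (x : H →L[ℂ] H) : ℝ :=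
  Real.sqrt (τ (star x * x)).re

/-- `E` is the `τ`-preserving conditional expectation of `M` onto `B`. -/
def IsCondExp (M B : Set (H →L[ℂ] H)) (τ : (H →L[ℂ] H) → ℂ)
    (E : (H →L[ℂ] H) → (H →L[ℂ] H)) : Prop :=
  (∀ x ∈ M, E x ∈ B) ∧ (∀ x ∈ M, ∀ b ∈ B, τ ((x - E x) * b) = 0)

/-- `A` is a maximal abelian *-subalgebra (MASA) of `M`. -/
def IsMasa (M A : Set (H →L[ℂ] H)) : Prop :=
  A ⊆ M ∧ (∀ a ∈ A, star a ∈ A) ∧ {x ∈ M | ∀ a ∈ A, x * a = a * x} = A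

/-- `u` is a unitary operator. -/
def IsUnitary (u : H →L[ℂ] H) : Prop :=
  star u * u = 1 ∧ u * star u = 1

/-- The set of normalizing unitaries of `A` in `M`: unitaries `u ∈ M` with `uAu* = A`. -/
def normalizerSet (M A : Set (H →L[ℂ] H)) : Set (H →L[ℂ] H) :=
  {u | u ∈ M ∧ IsUnitary u ∧ (fun a => u * a * star u) '' A = A}

/-- The normalizing algebra `N_M(A)''` of `A` in `M`. -/
def normAlg (M A : Set (H →L[ℂ] H)) : Set (H →L[ℂ] H) :=
  vNgen (normalizerSet M A)

/-- The triple `B ⊆ N ⊆ M` satisfies the relative weak asymptotic homomorphism property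
relative to the trace `τ` and the conditional expectations `EB` and `EN`. -/
def RelWAHP (M N B : Set (H →L[ℂ] H)) (τ : (H →L[ℂ] H) → ℂ)
    (EB EN : (H →L[ℂ] H) → (H →L[ℂ] H)) : Prop :=
  ∀ (n : ℕ) (x : Fin n → (H →L[ℂ] H)), (∀ i, x i ∈ M) →
    ∀ ε : ℝ, 0 < ε → ∃ u ∈ B, IsUnitary u ∧
      ∀ i j, norm2 τ (EB (x i * u * x j) - EB (EN (x i) * u * EN (x j))) < ε

/-- The conjugated conditional expectation `E_{uAu*}(x) = u E_A(u* x u) u*`. -/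
def conjCondExp (EA : (H →L[ℂ] H) → (H →L[ℂ] H)) (u : H →L[ℂ] H)
    (x : H →L[ℂ] H) : H →L[ℂ] H :=
  u * EA (star u * x * u) * star u

/-- `‖Φ‖_{∞,2} = sup {‖Φ(x)‖₂ : x ∈ M, ‖x‖ ≤ 1}` for a map `Φ`, where `‖x‖` is the
operator norm. -/
def normInfty2 (M : Set (H →L[ℂ] H)) (τ : (H →L[ℂ] H) → ℂ)
    (Φ : (H →L[ℂ] H) → (H →L[ℂ] H)) : ℝ :=
  sSup {r : ℝ | ∃ x ∈ M, ‖x‖ ≤ 1 ∧ r = norm2 τ (Φ x)}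

namespace SinclairSmith

set_option linter.unusedSectionVars false

open scoped InnerProductSpace Topology
open Filter

/-- Convergence in the weak operator topology along a filter. -/
def WOTLim {ι : Type*} (l : Filter ι) (x : ι → H →L[ℂ] H) (x₀ : H →L[ℂ] H) : Prop :=
  ∀ ξ η : H, Tendsto (fun i => ⟪ξ, x i η⟫_ℂ) l (𝓝 ⟪ξ, x₀ η⟫_ℂ)

section WOTLim

variable {ι : Type*} {l : Filter ι} {x y : ι → H →L[ℂ] H} {x₀ y₀ : H →L[ℂ] H}

theorem exists_wotLim (l : Ultrafilter ι) (x : ι → H →L[ℂ] H) (C : ℝ) (hx : ∀ i, ‖x i‖ ≤ C) :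
    ∃ x₀, WOTLim l x x₀ := by
  have key : ∀ ξ η : H, ∃ c : ℂ, Tendsto (fun i => ⟪x i ξ, η⟫_ℂ) l (𝓝 c) ∧
      ‖c‖ ≤ C * ‖ξ‖ * ‖η‖ := by
    intro ξ η
    have hb : ∀ i, ⟪x i ξ, η⟫_ℂ ∈ Metric.closedBall (0 : ℂ) (C * ‖ξ‖ * ‖η‖) := by
      intro i
      rw [mem_closedBall_zero_iff]
      refine (norm_inner_le_norm _ _).trans ?_
      gcongr
      exact ((x i).le_opNorm ξ).trans (by gcongr; exact hx i)
    obtain ⟨c, hc, hlim⟩ := (isCompact_closedBall (0 : ℂ) (C * ‖ξ‖ * ‖η‖)).ultrafilter_le_nhds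
      (l.map fun i => ⟪x i ξ, η⟫_ℂ) (by
        exact le_principal_iff.2 (Filter.mem_map.2 (Filter.univ_mem' hb)))
    exact ⟨c, hlim, by simpa using hc⟩
  choose B hB hBn using key
  have hne : (l : Filter ι).NeBot := l.neBot
  let B' : H →ₗ⋆[ℂ] H →ₗ[ℂ] ℂ := LinearMap.mk₂'ₛₗ (starRingEnd ℂ) (RingHom.id ℂ) B
    (fun a b c => tendsto_nhds_unique (hB _ _) (by
      simpa [inner_add_left] using (hB a c).add (hB b c)))
    (fun r a b => tendsto_nhds_unique (hB _ _) (by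
      simpa [inner_smul_left, mul_comm] using (hB a b).const_mul ((starRingEnd ℂ) r)))
    (fun a b c => tendsto_nhds_unique (hB _ _) (by
      simpa [inner_add_right] using (hB a b).add (hB a c)))
    (fun r a b => tendsto_nhds_unique (hB _ _) (by
      simpa [inner_smul_right] using (hB a b).const_mul r))
  let B'' : H →L⋆[ℂ] H →L[ℂ] ℂ := B'.mkContinuous₂ C hBn
  refine ⟨InnerProductSpace.continuousLinearMapOfBilin B'', fun ξ η => ?_⟩
  have h := (hB η ξ).star
  have e : star (B η ξ) = ⟪ξ, (InnerProductSpace.continuousLinearMapOfBilin B'') η⟫_ℂ := by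
    have : B η ξ = B'' η ξ := rfl
    rw [this, ← InnerProductSpace.continuousLinearMapOfBilin_apply]
    exact inner_conj_symm _ _
  rw [e] at h
  refine h.congr fun i => inner_conj_symm _ _

theorem WOTLim.unique [l.NeBot] (h : WOTLim l x x₀) (h' : WOTLim l x y₀) : x₀ = y₀ := by
  ext η
  exact ext_inner_left ℂ fun ξ => tendsto_nhds_unique (h ξ η) (h' ξ η)

theorem WOTLim.sub (h : WOTLim l x x₀) (h' : WOTLim l y y₀) :
    WOTLim l (fun i => x i - y i) (x₀ - y₀) := fun ξ η => by
  simpa [inner_sub_right] using (h ξ η).sub (h' ξ η)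

theorem WOTLim.const_mul (a : H →L[ℂ] H) (h : WOTLim l x x₀) :
    WOTLim l (fun i => a * x i) (a * x₀) := fun ξ η => by
  simpa [ContinuousLinearMap.adjoint_inner_left] using h (ContinuousLinearMap.adjoint a ξ) η

theorem WOTLim.mul_const (h : WOTLim l x x₀) (a : H →L[ℂ] H) :
    WOTLim l (fun i => x i * a) (x₀ * a) := fun ξ η => by
  simpa using h ξ (a η)

theorem WOTLim.congr' (h : WOTLim l x x₀) (hxy : ∀ᶠ i in l, x i = y i) : WOTLim l y x₀ :=
  fun ξ η => (h ξ η).congr' (hxy.mono fun i hi => by rw [hi])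

theorem wotLim_const : WOTLim l (fun _ => x₀) x₀ := fun _ _ => tendsto_const_nhds

theorem WOTLim.mem [l.NeBot] (h : WOTLim l x x₀) (M : VonNeumannAlgebra H) (hx : ∀ i, x i ∈ M) :
    x₀ ∈ M := by
  rw [← M.commutant_commutant, VonNeumannAlgebra.mem_commutant_iff]
  intro c hc
  rw [VonNeumannAlgebra.mem_commutant_iff] at hc
  exact (h.const_mul c).unique ((h.mul_const c).congr' (.of_forall fun i => hc _ (hx i)))

theorem WOTLim.nonneg [l.NeBot] (h : WOTLim l x x₀) (hx : ∀ᶠ i in l, 0 ≤ x i) : 0 ≤ x₀ := by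
  rw [ContinuousLinearMap.nonneg_iff_isPositive, ContinuousLinearMap.isPositive_iff_complex]
  intro ξ
  have h1 : 0 ≤ ⟪ξ, x₀ ξ⟫_ℂ := ge_of_tendsto (h ξ ξ) (hx.mono fun i hi =>
    ((ContinuousLinearMap.nonneg_iff_isPositive _).1 hi).inner_nonneg_right ξ)
  have h2 : ⟪x₀ ξ, ξ⟫_ℂ = ⟪ξ, x₀ ξ⟫_ℂ := by
    rw [← inner_conj_symm]
    exact (RCLike.conj_eq_iff_im).2 (RCLike.nonneg_iff.1 h1).2
  rw [h2]
  exact ⟨Complex.ext (by simp) (by simpa using (Complex.nonneg_iff.1 h1).2),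
    (RCLike.nonneg_iff.1 h1).1⟩

end WOTLim

section Basic

variable (M : VonNeumannAlgebra H)

theorem smul_mem_vN {M : VonNeumannAlgebra H} (c : ℂ) {x : H →L[ℂ] H} (hx : x ∈ M) : c • x ∈ M :=
  M.toStarSubalgebra.smul_mem hx c

theorem cfc_mem {M : VonNeumannAlgebra H} {a : H →L[ℂ] H} (ha : a ∈ M) (f : ℝ → ℝ) :
    cfc f a ∈ M := by
  rw [← M.commutant_commutant, VonNeumannAlgebra.mem_commutant_iff]
  intro c hc
  rw [VonNeumannAlgebra.mem_commutant_iff] at hc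
  exact (Commute.cfc_real (hc a ha) f).symm

/-- The support projection of `a`. -/
theorem exists_support {M : VonNeumannAlgebra H} {a : H →L[ℂ] H} (ha : a ∈ M) :
    ∃ e ∈ M, IsStarProjection e ∧ (∀ t : H →L[ℂ] H, (∀ ξ, a ξ = 0 → t ξ = 0) → t * e = t) ∧
      ∀ t : H →L[ℂ] H, a * t = 0 → e * t = 0 := by
  set K : Submodule ℂ H := a.ker with hK
  have hKc : IsClosed (K : Set H) := a.isClosed_ker
  have : K.HasOrthogonalProjection := by
    have := hKc.completeSpace_coe
    infer_instance
  refine ⟨Kᗮ.starProjection, ?_, isStarProjection_starProjection, ?_, ?_⟩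
  · rw [VonNeumannAlgebra.IsStarProjection.mem_iff isStarProjection_starProjection]
    intro c hc
    rw [Submodule.range_starProjection, Module.End.mem_invtSubmodule]
    intro ξ hξ
    rw [Submodule.mem_comap, Submodule.mem_orthogonal]
    intro η hη
    have h2 := (VonNeumannAlgebra.mem_commutant_iff.1 (star_mem hc)) a ha
    have h3 : (star c) η ∈ K := by
      have := congr($h2 η)
      change a ((star c) η) = (star c) (a η) at this
      have h0 : a η = 0 := hη
      change a ((star c) η) = 0
      rw [this, h0, map_zero]
    have := (Submodule.mem_orthogonal _ _).1 hξ _ h3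
    rw [ContinuousLinearMap.star_eq_adjoint, ContinuousLinearMap.adjoint_inner_left] at this
    exact this
  · intro t ht
    ext ξ
    have h1 : ξ - Kᗮ.starProjection ξ ∈ K := by
      rw [Submodule.starProjection_orthogonal]
      simp
    have := ht _ h1
    rw [map_sub, sub_eq_zero] at this
    simpa using this.symm
  · intro t ht
    ext ξ
    have h1 : t ξ ∈ K := congr($ht ξ)
    change Kᗮ.starProjection (t ξ) = 0
    rw [Submodule.starProjection_apply_eq_zero_iff, Submodule.orthogonal_orthogonal]
    exact h1

end Basic

section

/-- A linear functional whose restriction to `M` is a faithful tracial state. -/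
structure IsTrace (M : VonNeumannAlgebra H) (T : (H →L[ℂ] H) →ₗ[ℂ] ℂ) : Prop where
  one : T 1 = 1
  nonneg_star : ∀ x ∈ M, 0 ≤ T (star x * x)
  comm : ∀ x ∈ M, ∀ y ∈ M, T (x * y) = T (y * x)
  faithful : ∀ x ∈ M, T (star x * x) = 0 → x = 0

variable {M : VonNeumannAlgebra H} {T : (H →L[ℂ] H) →ₗ[ℂ] ℂ}

theorem exists_sqrt {a : H →L[ℂ] H} (ha : a ∈ M) (h0 : 0 ≤ a) :
    ∃ c ∈ M, 0 ≤ c ∧ star c = c ∧ c * c = a := by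
  refine ⟨cfc Real.sqrt a, cfc_mem ha _, cfc_nonneg fun x _ => Real.sqrt_nonneg x,
    (IsSelfAdjoint.star_eq (cfc_predicate _ _)), ?_⟩
  rw [← cfc_mul Real.sqrt Real.sqrt a]
  conv_rhs => rw [← cfc_id' ℝ a]
  refine cfc_congr fun x hx => ?_
  exact Real.mul_self_sqrt (spectrum_nonneg_of_nonneg h0 hx)

namespace IsTrace

theorem nonneg (hT : IsTrace M T) {a : H →L[ℂ] H} (ha : a ∈ M) (h0 : 0 ≤ a) : 0 ≤ T a := by
  obtain ⟨c, hc, -, hs, rfl⟩ := exists_sqrt ha h0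
  simpa [hs] using hT.nonneg_star c hc

theorem mono (hT : IsTrace M T) {a b : H →L[ℂ] H} (ha : a ∈ M) (hb : b ∈ M) (h : a ≤ b) :
    T a ≤ T b := by
  simpa using hT.nonneg (sub_mem hb ha) (sub_nonneg.2 h)

theorem eq_zero (hT : IsTrace M T) {a : H →L[ℂ] H} (ha : a ∈ M) (h0 : 0 ≤ a) (h : T a = 0) :
    a = 0 := by
  obtain ⟨c, hc, -, hs, rfl⟩ := exists_sqrt ha h0
  rw [hT.faithful c hc (by rwa [hs]), mul_zero]

theorem star_apply (hT : IsTrace M T) {x : H →L[ℂ] H} (hx : x ∈ M) :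
    T (star x) = star (T x) := by
  have h1 := (Complex.nonneg_iff.1 (hT.nonneg_star (1 + x) (add_mem (one_mem M) hx))).2
  have h2 := (Complex.nonneg_iff.1 (hT.nonneg_star (1 + Complex.I • x)
    (add_mem (one_mem M) (smul_mem_vN _ hx)))).2
  have h3 := (Complex.nonneg_iff.1 (hT.nonneg_star x hx)).2
  simp [add_mul, mul_add, hT.one] at h1 h2
  apply Complex.ext
  · simp; linarith
  · simp; linarith

theorem im_eq_zero (hT : IsTrace M T) {x : H →L[ℂ] H} (hx : x ∈ M) (h : star x = x) :
    (T x).im = 0 := by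
  have := congr(($(hT.star_apply hx)).im)
  rw [h] at this
  simp at this
  linarith

theorem re_nonneg (hT : IsTrace M T) {a : H →L[ℂ] H} (ha : a ∈ M) (h0 : 0 ≤ a) : 0 ≤ (T a).re :=
  (Complex.nonneg_iff.1 (hT.nonneg ha h0)).1

theorem re_mono (hT : IsTrace M T) {a b : H →L[ℂ] H} (ha : a ∈ M) (hb : b ∈ M) (h : a ≤ b) :
    (T a).re ≤ (T b).re :=
  (Complex.le_def.1 (hT.mono ha hb h)).1

theorem cauchySchwarz (hT : IsTrace M T) {x y : H →L[ℂ] H} (hx : x ∈ M) (hy : y ∈ M) :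
    ‖T (star x * y)‖ ^ 2 ≤ (T (star x * x)).re * (T (star y * y)).re := by
  have hyx : T (star y * x) = star (T (star x * y)) := by
    rw [← hT.star_apply (mul_mem (star_mem hx) hy)]; simp
  by_cases h0 : T (star x * x) = 0
  · rw [hT.faithful x hx h0]; simp
  set s := (T (star x * x)).re with hs
  have hs' : T (star x * x) = s := by
    apply Complex.ext
    · simp [hs]
    · simpa using (Complex.nonneg_iff.1 (hT.nonneg_star x hx)).2.symm
  have hs0 : 0 < s := lt_of_le_of_ne (Complex.nonneg_iff.1 (hT.nonneg_star x hx)).1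
    fun h => h0 (by rw [hs', ← h]; simp)
  set β := T (star x * y) with hβ
  have key := (Complex.nonneg_iff.1 (hT.nonneg_star ((s : ℂ) • y - β • x)
    (sub_mem (smul_mem_vN _ hy) (smul_mem_vN _ hx)))).1
  have e : star ((s : ℂ) • y - β • x) * ((s : ℂ) • y - β • x)
      = ((s : ℂ) * s) • (star y * y) - (s * β) • (star y * x) - (star β * s) • (star x * y)
        + (star β * β) • (star x * x) := by
    simp only [star_sub, star_smul, sub_mul, mul_sub, smul_mul_assoc, mul_smul_comm,
      Complex.star_def, Complex.conj_ofReal]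
    module
  have e2 : T (star ((s : ℂ) • y - β • x) * ((s : ℂ) • y - β • x)) =
      s * (s * T (star y * y) - (‖β‖ ^ 2 : ℝ)) := by
    rw [e]
    simp only [map_add, map_sub, map_smul, hyx, hs', ← hβ, smul_eq_mul]
    have : ((‖β‖ ^ 2 : ℝ) : ℂ) = β * star β := by
      rw [← Complex.normSq_eq_norm_sq, Complex.normSq_eq_conj_mul_self, mul_comm]; rfl
    rw [this]
    ring
  rw [e2, Complex.re_ofReal_mul] at key
  have := nonneg_of_mul_nonneg_right key hs0
  simp only [Complex.sub_re, Complex.re_ofReal_mul, Complex.ofReal_re] at this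
  linarith

/-- A nonzero positive element under which the trace is dominated by a vector state. -/
theorem exists_dominated (hT : IsTrace M T) [Nontrivial H] :
    ∃ b ∈ M, 0 ≤ b ∧ b ≠ 0 ∧ ∃ ξ : H, ∀ c ∈ M, 0 ≤ c → c ≤ b → (T c).re ≤ (⟪ξ, c ξ⟫_ℂ).re := by
  obtain ⟨ξ, hξ⟩ := NormedSpace.exists_lt_norm ℂ H 1
  let D : Set (H →L[ℂ] H) := {a | a ∈ M ∧ 0 ≤ a ∧ a ≤ 1 ∧ (⟪ξ, a ξ⟫_ℂ).re ≤ (T a).re}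
  have h0D : (0 : H →L[ℂ] H) ∈ D := ⟨zero_mem M, le_rfl, zero_le_one, by simp⟩
  obtain ⟨a, -, ⟨haM, ha0, ha1, haT⟩, hmax⟩ := zorn_le_nonempty₀ D (by
    intro c hcD hc y hy
    have : Nonempty c := ⟨⟨y, hy⟩⟩
    have : IsDirectedOrder c := ⟨fun i j => (hc.directedOn.directed_val) i j⟩
    let l : Ultrafilter c := Ultrafilter.of atTop
    have hl : (l : Filter c) ≤ atTop := Ultrafilter.of_le atTop
    have hlb : (l : Filter c).NeBot := l.neBot
    obtain ⟨L, hL⟩ := exists_wotLim l (fun i : c => (i : H →L[ℂ] H)) 1 fun i =>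
      (CStarAlgebra.norm_le_one_iff_of_nonneg _ (hcD i.2).2.1).2 (hcD i.2).2.2.1
    have hLM : L ∈ M := hL.mem M fun i => (hcD i.2).1
    have hub : ∀ z ∈ c, z ≤ L := fun z hz => by
      rw [← sub_nonneg]
      exact (hL.sub wotLim_const).nonneg (hl ((eventually_ge_atTop (⟨z, hz⟩ : c)).mono
        fun i hi => sub_nonneg.2 hi))
    refine ⟨L, ⟨hLM, hL.nonneg (.of_forall fun i => (hcD i.2).2.1), ?_, ?_⟩, hub⟩
    · rw [← sub_nonneg]
      exact (wotLim_const.sub hL).nonneg (.of_forall fun i => sub_nonneg.2 (hcD i.2).2.2.1)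
    · refine le_of_tendsto ((Complex.continuous_re.tendsto _).comp (hL ξ ξ)) (.of_forall fun i => ?_)
      exact (hcD i.2).2.2.2.trans (hT.re_mono (hcD i.2).1 hLM (hub _ i.2))) 0 h0D
  refine ⟨1 - a, sub_mem (one_mem M) haM, sub_nonneg.2 ha1, fun h => ?_, ξ, fun c hc hc0 hcb => ?_⟩
  · rw [sub_eq_zero] at h
    rw [← h, hT.one, one_apply_eq_self, inner_self_eq_norm_sq_to_K] at haT
    simp only [Complex.coe_algebraMap, ← Complex.ofReal_pow, Complex.ofReal_re, Complex.one_re] at haT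
    nlinarith
  · by_contra! hlt
    have := hmax (y := a + c) ⟨add_mem haM hc, add_nonneg ha0 hc0, by
      rwa [le_sub_iff_add_le'] at hcb, by
        simp only [add_apply, inner_add_right, map_add, Complex.add_re]
        linarith⟩ (le_add_of_nonneg_right hc0)
    have hc' : c = 0 := le_antisymm (by simpa using this) hc0
    simp [hc'] at hlt

theorem exists_local_vector (hT : IsTrace M T) [Nontrivial H] :
    ∃ b ∈ M, 0 ≤ b ∧ b ≠ 0 ∧ ∃ η ζ : H, ∀ x ∈ M, T (b * x) = ⟪η, x ζ⟫_ℂ := by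
  obtain ⟨b, hb, hb0, hbne, ξ, hξ⟩ := hT.exists_dominated
  obtain ⟨c, hc, hc0, hcs, hcb⟩ := exists_sqrt hb hb0
  have hpos : ∀ x ∈ M, 0 ≤ x → x ≤ 1 → (T (c * x * c)).re ≤ (⟪c ξ, x (c ξ)⟫_ℂ).re := by
    intro x hx hx0 hx1
    have hsa : IsSelfAdjoint c := hcs
    have := hξ (c * x * c) (mul_mem (mul_mem hc hx) hc) (hsa.conjugate_nonneg hx0) (by
      simpa [hcb] using hsa.conjugate_le_conjugate hx1)
    refine this.trans_eq ?_
    have h2 : ⟪ξ, c (x (c ξ))⟫_ℂ = ⟪c ξ, x (c ξ)⟫_ℂ := by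
      rw [← ContinuousLinearMap.adjoint_inner_left, ← ContinuousLinearMap.star_eq_adjoint, hcs]
    exact congr(($h2).re)
  set ζ := c ξ with hζ
  have hnorm : ∀ x ∈ M, (T (c * (star x * x) * c)).re ≤ ‖x ζ‖ ^ 2 := by
    intro x hx
    by_cases hx0 : x = 0
    · simp [hx0]
    have hn : 0 < ‖x‖ := norm_pos_iff.2 hx0
    have := hpos (((‖x‖ ^ 2 : ℝ)⁻¹ : ℂ) • (star x * x)) (smul_mem_vN _ (mul_mem (star_mem hx) hx))
      (smul_nonneg (by rw [Complex.ofReal_pow, inv_nonneg]; positivity) (star_mul_self_nonneg x)) (by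
        rw [← CStarAlgebra.norm_le_one_iff_of_nonneg _ (smul_nonneg (by
          rw [Complex.ofReal_pow, inv_nonneg]; positivity) (star_mul_self_nonneg x)), norm_smul,
          CStarRing.norm_star_mul_self]
        simp
        field_simp
        rfl)
    have e : ⟪ζ, (star x * x) ζ⟫_ℂ = (‖x ζ‖ ^ 2 : ℝ) := by
      have : (star x * x) ζ = ContinuousLinearMap.adjoint x (x ζ) := rfl
      rw [this, ContinuousLinearMap.adjoint_inner_right, inner_self_eq_norm_sq_to_K]
      norm_cast
    simp only [mul_smul_comm, smul_mul_assoc, map_smul, smul_apply,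
      inner_smul_right, smul_eq_mul] at this
    rw [e, ← Complex.ofReal_inv, Complex.re_ofReal_mul, Complex.re_ofReal_mul, Complex.ofReal_re] at this
    exact le_of_mul_le_mul_left this (by positivity)
  have hbd : ∀ x ∈ M, ‖T (b * x)‖ ≤ √(T b).re * ‖x ζ‖ := by
    intro x hx
    have h1 : T (b * x) = T (star c * (x * c)) := by
      rw [hcs, ← hcb, mul_assoc, hT.comm c hc _ (mul_mem hc hx), mul_assoc]
    have h2 := hT.cauchySchwarz hc (mul_mem hx hc)
    have h3 : star (x * c) * (x * c) = c * (star x * x) * c := by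
      simp [hcs, mul_assoc]
    rw [← h1, h3, hcs, hcb] at h2
    have h4 := hT.re_nonneg hb hb0
    refine abs_le_of_sq_le_sq' ?_ (by positivity) |>.2
    rw [mul_pow, Real.sq_sqrt h4]
    exact h2.trans (mul_le_mul_of_nonneg_left (hnorm x hx) h4)
  refine ⟨b, hb, hb0, hbne, ?_⟩
  let S : Submodule ℂ (H →L[ℂ] H) := M.toStarSubalgebra.toSubalgebra.toSubmodule
  let p : S →ₗ[ℂ] H := (ContinuousLinearMap.apply ℂ H ζ).toLinearMap ∘ₗ S.subtype
  let q : S →ₗ[ℂ] ℂ := T ∘ₗ LinearMap.mulLeft ℂ b ∘ₗ S.subtype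
  have hpq : ∀ x : S, ‖q x‖ ≤ √(T b).re * ‖p x‖ := fun x => hbd x x.2
  obtain ⟨s, hs⟩ := LinearMap.exists_rightInverse_of_surjective p.rangeRestrict
    (LinearMap.range_rangeRestrict p)
  have hs' : ∀ v, p (s v) = v := fun v => congr((($hs) v : H))
  let g : LinearMap.range p →L[ℂ] ℂ := (q ∘ₗ s).mkContinuous (√(T b).re) fun v => by
    have := hpq (s v)
    rw [hs'] at this
    exact this
  obtain ⟨G, hG, -⟩ := exists_extension_norm_eq _ g
  refine ⟨(InnerProductSpace.toDual ℂ H).symm G, ζ, fun x hx => ?_⟩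
  rw [InnerProductSpace.toDual_symm_apply]
  have h1 := hG (p.rangeRestrict ⟨x, hx⟩)
  have h2 : (q (s (p.rangeRestrict ⟨x, hx⟩)) : ℂ) = q ⟨x, hx⟩ := by
    rw [← sub_eq_zero, ← map_sub, ← norm_le_zero_iff]
    refine (hpq _).trans ?_
    rw [map_sub, hs']
    simp
  exact (h1.trans h2).symm

theorem exists_local_vector_projection (hT : IsTrace M T) [Nontrivial H] :
    ∃ f ∈ M, IsStarProjection f ∧ f ≠ 0 ∧ ∃ η ζ : H, ∀ x ∈ M, T (f * x) = ⟪η, x ζ⟫_ℂ := by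
  obtain ⟨b, hb, hb0, hbne, η, ζ, h⟩ := hT.exists_local_vector
  set ε := ‖b‖ / 2 with hε
  have hε0 : 0 < ε := half_pos (norm_pos_iff.2 hbne)
  have hbs : IsSelfAdjoint b := .of_nonneg hb0
  set c := cfc (fun t : ℝ => max (t - ε) 0) b with hc
  set k := cfc (fun t : ℝ => (max t ε)⁻¹) b with hk
  have hcont : Continuous fun t : ℝ => (max t ε)⁻¹ :=
    (continuous_id.max continuous_const).inv₀ fun t => (lt_max_of_lt_right hε0).ne'
  have hbk : b * k = cfc (fun t : ℝ => t * (max t ε)⁻¹) b := by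
    rw [cfc_mul (fun t : ℝ => t) (fun t : ℝ => (max t ε)⁻¹) b (by fun_prop) hcont.continuousOn,
      cfc_id' ℝ b]
  have hcbk : c * (b * k) = c := by
    rw [hbk, hc, ← cfc_mul (fun t : ℝ => max (t - ε) 0) (fun t : ℝ => t * (max t ε)⁻¹) b (by fun_prop)
      (continuous_id.mul hcont).continuousOn]
    refine cfc_congr fun t _ => ?_
    rcases le_total t ε with h | h
    · simp [h]
    · have : t ≠ 0 := (hε0.trans_le h).ne'
      simp [h, this]
  obtain ⟨f, hf, hfp, hf1, hf2⟩ := exists_support (cfc_mem (M := M) hb (fun t : ℝ => max (t - ε) 0))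
  have hfk : f * (b * k) = f := by
    have := hf2 (b * k - 1) (by rw [mul_sub, hcbk, mul_one, sub_self])
    rwa [mul_sub, mul_one, sub_eq_zero] at this
  have hsf : star f = f := hfp.isSelfAdjoint
  have hkM : k ∈ M := cfc_mem hb _
  have hbkf : (b * k) * f = f := by
    have h1 : star (b * k) = b * k := by
      rw [hbk]; exact cfc_predicate (p := IsSelfAdjoint) _ b
    have := congr(star $hfk)
    rwa [star_mul, h1, hsf] at this
  refine ⟨f, hf, hfp, fun h0 => ?_, star (k * f) η, ζ, fun x hx => ?_⟩
  · have hc0 : c = 0 := by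
      have := hf1 c fun _ h => h
      rw [h0, mul_zero] at this
      exact this.symm
    have hb' : b = cfc (fun t : ℝ => min t ε) b := by
      have : cfc (fun t : ℝ => min t ε) b + c = b := by
        rw [hc, ← cfc_add b (fun t : ℝ => min t ε) (fun t : ℝ => max (t - ε) 0) (by fun_prop) (by fun_prop)]
        conv_rhs => rw [← cfc_id' ℝ b]
        refine cfc_congr fun t _ => ?_
        rcases le_total t ε with h | h <;> simp [h]
      rw [hc0, add_zero] at this
      exact this.symm
    have : ‖b‖ ≤ ε := by
      rw [hb']
      refine norm_cfc_le hε0.le fun t ht => ?_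
      rw [Real.norm_eq_abs, abs_le]
      exact ⟨le_min (by linarith [spectrum_nonneg_of_nonneg hb0 ht]) (by linarith), min_le_right _ _⟩
    linarith
  · have e : f * x = b * (k * f * x) := by
      rw [← mul_assoc, ← mul_assoc, hbkf]
    rw [e, h _ (mul_mem (mul_mem hkM hf) hx), ContinuousLinearMap.star_eq_adjoint,
      ContinuousLinearMap.adjoint_inner_left]
    rfl

end IsTrace

theorem mem_of_ker_invariant {M : VonNeumannAlgebra H} (K : Submodule ℂ H)
    [K.HasOrthogonalProjection] (h : ∀ c ∈ M.commutant, ∀ ξ ∈ K, c ξ ∈ K) :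
    K.starProjection ∈ M := by
  rw [VonNeumannAlgebra.IsStarProjection.mem_iff isStarProjection_starProjection]
  intro c hc
  rw [Submodule.range_starProjection, Module.End.mem_invtSubmodule]
  exact fun ξ hξ => h c hc ξ hξ

theorem factor_mul_eq_zero (hM : ∀ x ∈ M, (∀ y ∈ M, x * y = y * x) → ∃ c : ℂ, x = c • 1)
    {a b : H →L[ℂ] H} (ha : a ∈ M) (h : ∀ m ∈ M, a * m * b = 0) : a = 0 ∨ b = 0 := by
  let K : Submodule ℂ H := ⨅ m : M, (a * (m : H →L[ℂ] H)).ker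
  have hK : ∀ ξ, ξ ∈ K ↔ ∀ m ∈ M, a (m ξ) = 0 := fun ξ => by
    simp [K, Submodule.mem_iInf]
  have hKc : IsClosed (K : Set H) := by
    simp only [K, Submodule.coe_iInf]
    exact isClosed_iInter fun m => (a * (m : H →L[ℂ] H)).isClosed_ker
  have : K.HasOrthogonalProjection := by
    have := hKc.completeSpace_coe
    infer_instance
  have h1 : K.starProjection ∈ M := mem_of_ker_invariant K fun c hc ξ hξ => by
    rw [hK] at hξ ⊢
    intro m hm
    have e := congr($(VonNeumannAlgebra.mem_commutant_iff.1 hc (a * m) (mul_mem ha hm)) ξ)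
    change a (m (c ξ)) = c (a (m ξ)) at e
    rw [e, hξ m hm, map_zero]
  have h2 : K.starProjection ∈ M.commutant := mem_of_ker_invariant K fun c hc ξ hξ => by
    rw [M.commutant_commutant] at hc
    rw [hK] at hξ ⊢
    intro m hm
    exact hξ (m * c) (mul_mem hm hc)
  rw [VonNeumannAlgebra.mem_commutant_iff] at h2
  obtain ⟨c, hc⟩ := hM _ h1 fun y hy => (h2 y hy).symm
  by_cases hc0 : c = 0
  · right
    ext ξ
    have : K.starProjection (b ξ) = b ξ := by
      rw [Submodule.starProjection_eq_self_iff, hK]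
      exact fun m hm => congr($(h m hm) ξ)
    rw [hc, hc0] at this
    simpa using this.symm
  · left
    ext ξ
    have h3 : K.starProjection ξ ∈ K := by simp
    rw [hK] at h3
    have := h3 1 (one_mem M)
    rw [hc] at this
    simpa [hc0] using this

end

section

variable {M : VonNeumannAlgebra H} {T : (H →L[ℂ] H) →ₗ[ℂ] ℂ}

section Row

variable {n : ℕ}

/-- The row operator `(w k)` is a contraction. -/
def RowContraction (w : Fin n → H →L[ℂ] H) : Prop :=
  ∀ (ξ : H) (η : Fin n → H), ‖∑ k, ⟪ξ, w k (η k)⟫_ℂ‖ ≤ ‖ξ‖ * √(∑ k, ‖η k‖ ^ 2)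

theorem inner_sum_mul_star (w : Fin n → H →L[ℂ] H) (ξ : H) :
    ⟪(∑ k, w k * star (w k)) ξ, ξ⟫_ℂ = ((∑ k, ‖star (w k) ξ‖ ^ 2 : ℝ) : ℂ) := by
  rw [sum_apply, sum_inner, Complex.ofReal_sum]
  refine Finset.sum_congr rfl fun k _ => ?_
  have : (w k * star (w k)) ξ = w k (star (w k) ξ) := rfl
  rw [this, ← ContinuousLinearMap.adjoint_inner_right, ← ContinuousLinearMap.star_eq_adjoint,
    inner_self_eq_norm_sq_to_K]
  simp

theorem rowContraction_iff (w : Fin n → H →L[ℂ] H) :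
    RowContraction w ↔ ∑ k, w k * star (w k) ≤ 1 := by
  have h1 : ∑ k, w k * star (w k) ≤ 1 ↔ ∀ ξ, ∑ k, ‖star (w k) ξ‖ ^ 2 ≤ ‖ξ‖ ^ 2 := by
    rw [ContinuousLinearMap.le_def, ContinuousLinearMap.isPositive_iff_complex]
    refine forall_congr' fun ξ => ?_
    rw [sub_apply, inner_sub_left, inner_sum_mul_star, one_apply_eq_self, inner_self_eq_norm_sq_to_K]
    simp only [Complex.coe_algebraMap, ← Complex.ofReal_pow, ← Complex.ofReal_sub,
      RCLike.re_eq_complex_re, Complex.ofReal_re, true_and, sub_nonneg]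
  have e : ∀ ξ (η : Fin n → H), ∑ k, ⟪ξ, w k (η k)⟫_ℂ = ∑ k, ⟪star (w k) ξ, η k⟫_ℂ :=
    fun ξ η => Finset.sum_congr rfl fun k _ => by
      rw [ContinuousLinearMap.star_eq_adjoint, ContinuousLinearMap.adjoint_inner_left]
  rw [h1]
  constructor
  · intro h ξ
    have := h ξ fun k => star (w k) ξ
    rw [e] at this
    have e2 : ∑ k, ⟪star (w k) ξ, star (w k) ξ⟫_ℂ = ((∑ k, ‖star (w k) ξ‖ ^ 2 : ℝ) : ℂ) := by
      rw [Complex.ofReal_sum]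
      exact Finset.sum_congr rfl fun k _ => by rw [inner_self_eq_norm_sq_to_K]; simp
    have h0 : 0 ≤ ∑ k, ‖star (w k) ξ‖ ^ 2 := Finset.sum_nonneg fun _ _ => sq_nonneg _
    rw [e2, Complex.norm_real, Real.norm_of_nonneg h0] at this
    set s := ∑ k, ‖star (w k) ξ‖ ^ 2
    have hs := Real.sq_sqrt h0
    have hs0 := Real.sqrt_nonneg s
    by_cases hz : √s = 0
    · have : s = 0 := by simpa [hz] using hs.symm
      rw [this]; positivity
    · have : √s ≤ ‖ξ‖ := by
        have hp : 0 < √s := lt_of_le_of_ne hs0 (Ne.symm hz)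
        nlinarith
      rw [← hs]
      gcongr
  · intro h ξ η
    rw [e]
    calc ‖∑ k, ⟪star (w k) ξ, η k⟫_ℂ‖ ≤ ∑ k, ‖star (w k) ξ‖ * ‖η k‖ :=
          norm_sum_le_of_le _ fun k _ => norm_inner_le_norm _ _
      _ ≤ √(∑ k, ‖star (w k) ξ‖ ^ 2) * √(∑ k, ‖η k‖ ^ 2) :=
          Real.sum_mul_le_sqrt_mul_sqrt _ _ _
      _ ≤ ‖ξ‖ * √(∑ k, ‖η k‖ ^ 2) := by
          gcongr
          exact Real.sqrt_le_iff.2 ⟨norm_nonneg _, h ξ⟩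

theorem RowContraction.norm_le_one {w : Fin n → H →L[ℂ] H} (hw : RowContraction w) (k : Fin n) :
    ‖w k‖ ≤ 1 := by
  refine ContinuousLinearMap.opNorm_le_bound _ zero_le_one fun η => ?_
  have := hw (w k η) (Pi.single k η)
  rw [Finset.sum_eq_single k (fun j _ hj => by simp [hj]) (by simp),
    Finset.sum_eq_single k (fun j _ hj => by simp [hj]) (by simp)] at this
  simp only [Pi.single_eq_same, inner_self_eq_norm_sq_to_K, Complex.coe_algebraMap, norm_pow,
    Complex.norm_real, norm_norm, Real.sqrt_sq (norm_nonneg η)] at this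
  by_cases h0 : ‖w k η‖ = 0
  · rw [h0]; positivity
  · have hp : 0 < ‖w k η‖ := lt_of_le_of_ne (norm_nonneg _) (Ne.symm h0)
    rw [one_mul]
    nlinarith

/-- Rows of operators of `M f` forming a contraction. -/
def rowBall (M : VonNeumannAlgebra H) (f : H →L[ℂ] H) (n : ℕ) : Set (Fin n → H →L[ℂ] H) :=
  {w | (∀ k, w k ∈ M) ∧ (∀ k, w k * f = w k) ∧ RowContraction w}

theorem exists_extreme_row (M : VonNeumannAlgebra H) (f : H →L[ℂ] H) (n : ℕ) :
    ∃ w ∈ rowBall M f n, ∀ z : Fin n → H →L[ℂ] H,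
      (fun k => w k + z k) ∈ rowBall M f n → (fun k => w k - z k) ∈ rowBall M f n →
      ∀ k, z k = 0 := by
  let Φ : (Fin n → H →L[ℂ] H) → (Fin n → H → H → ℂ) := fun w k ξ η => ⟪ξ, w k η⟫_ℂ
  have hΦ : Function.Injective Φ := fun w v h => by
    funext k
    ext η
    exact ext_inner_left ℂ fun ξ => congr($h k ξ η)
  have hne : (Φ '' rowBall M f n).Nonempty :=
    ⟨_, 0, ⟨fun _ => zero_mem M, fun _ => zero_mul f, fun ξ η => by simp; positivity⟩, rfl⟩
  have hcomp : IsCompact (Φ '' rowBall M f n) := by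
    rw [isCompact_iff_ultrafilter_le_nhds]
    intro F hF
    let Ψ : rowBall M f n → (Fin n → H → H → ℂ) := fun w => Φ w
    have hΨ : Function.Injective Ψ := hΦ.comp Subtype.val_injective
    have hr : Set.range Ψ ∈ F := by
      rw [le_principal_iff] at hF
      refine mem_of_superset hF ?_
      rintro _ ⟨w, hw, rfl⟩
      exact ⟨⟨w, hw⟩, rfl⟩
    let l := F.comap hΨ hr
    have hmap : (F : Filter _) = map Ψ l := by
      rw [Ultrafilter.coe_comap, map_comap_of_mem hr]
    have hlb : (l : Filter (rowBall M f n)).NeBot := l.neBot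
    choose w hw using fun k => exists_wotLim l (fun i : rowBall M f n => (i : Fin n → H →L[ℂ] H) k)
      1 fun i => i.2.2.2.norm_le_one k
    refine ⟨Φ w, ⟨w, ⟨fun k => (hw k).mem M fun i => i.2.1 k, fun k => ?_, fun ξ η => ?_⟩, rfl⟩, ?_⟩
    · exact ((hw k).mul_const f).unique ((hw k).congr' (.of_forall fun i => (i.2.2.1 k).symm))
    · exact le_of_tendsto (tendsto_finsetSum _ fun k _ => hw k ξ (η k)).norm
        (.of_forall fun i => i.2.2.2 ξ η)
    · rw [hmap]
      change Tendsto Ψ l (𝓝 (Φ w))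
      exact tendsto_pi_nhds.2 fun k => tendsto_pi_nhds.2 fun ξ => tendsto_pi_nhds.2 fun η =>
        hw k ξ η
  obtain ⟨_, ⟨w, hw, rfl⟩, hext⟩ := hcomp.extremePoints_nonempty hne
  refine ⟨w, hw, fun z h1 h2 k => ?_⟩
  have := hext ⟨_, h1, rfl⟩ ⟨_, h2, rfl⟩ ⟨1 / 2, 1 / 2, by norm_num, by norm_num, by norm_num, by
    funext k ξ η
    simp only [Φ, Pi.add_apply, Pi.smul_apply, add_apply, sub_apply, inner_add_right,
      inner_sub_right, Complex.real_smul]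
    push_cast
    ring⟩
  have := congr_fun (hΦ this) k
  simpa using this

theorem extreme_row_dichotomy {f : H →L[ℂ] H} (hf : f ∈ M) (hfp : IsStarProjection f)
    (hM : ∀ x ∈ M, (∀ y ∈ M, x * y = y * x) → ∃ c : ℂ, x = c • 1)
    {w : Fin n → H →L[ℂ] H} (hw : w ∈ rowBall M f n)
    (hext : ∀ z : Fin n → H →L[ℂ] H,
      (fun k => w k + z k) ∈ rowBall M f n → (fun k => w k - z k) ∈ rowBall M f n →
      ∀ k, z k = 0) :
    ∑ k, w k * star (w k) = 1 ∨ ∀ j, star (w j) * w j = f := by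
  obtain ⟨hwM, hwf, hwr⟩ := hw
  set D := 1 - ∑ k, w k * star (w k) with hD
  have hDM : D ∈ M := sub_mem (one_mem M) (sum_mem fun k _ => mul_mem (hwM k) (star_mem (hwM k)))
  have hD0 : 0 ≤ D := sub_nonneg.2 ((rowContraction_iff w).1 hwr)
  have hD1 : D ≤ 1 := sub_le_self _ (Finset.sum_nonneg fun k _ => mul_star_self_nonneg (w k))
  have hDs : IsSelfAdjoint D := .of_nonneg hD0
  have hDD : D * D ≤ D := by
    obtain ⟨c, -, -, hcs, hcc⟩ := exists_sqrt hDM hD0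
    have := IsSelfAdjoint.conjugate_le_conjugate (c := c) hD1 hcs
    have e : D * D = c * D * c := by rw [← hcc]; simp only [mul_assoc]
    rw [e]
    simpa [hcc] using this
  have hfs : star f = f := hfp.isSelfAdjoint
  have hff : f * f = f := hfp.isIdempotentElem
  have hf1 : f ≤ 1 := hfp.le_one
  have hfw : ∀ k, f * star (w k) = star (w k) := fun k => by
    have := congr(star $(hwf k))
    rwa [star_mul, hfs] at this
  have main : ∀ j, ∀ m ∈ M, ‖m‖ ≤ 1 / 3 → D * m * (f - star (w j) * w j) = 0 := by
    intro j m hm hmn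
    have hsum : ∑ k, w k * star (w k) = 1 - D := by rw [hD]; abel
    let g : Fin n → H →L[ℂ] H := fun k => (if j = k then f else 0) - star (w j) * w k
    have hgs : ∀ k, star (g k) = (if j = k then f else 0) - star (w k) * w j := fun k => by
      simp only [g]
      split_ifs <;> simp [hfs]
    have h1 : ∑ k, w k * star (g k) = D * w j := by
      simp only [hgs, mul_sub, Finset.sum_sub_distrib, mul_ite, mul_zero, hwf,
        Finset.sum_ite_eq, Finset.mem_univ, if_true, ← mul_assoc, ← Finset.sum_mul, hsum]
      rw [sub_mul]; simp
    have h2 : ∑ k, g k * star (g k) = f - star (w j) * w j - star (w j) * D * w j := by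
      have : ∀ k, g k * star (g k) = (if j = k then f - star (w j) * w j - star (w j) * w j else 0)
          + star (w j) * (w k * star (w k)) * w j := by
        intro k
        rw [hgs]
        simp only [g]
        split_ifs with h
        · subst h
          simp only [sub_mul, mul_sub, hff, ← mul_assoc, hfw, ]
          simp only [mul_assoc, hwf]
          abel
        · simp [mul_assoc]
      simp only [this, Finset.sum_add_distrib, ← Finset.sum_mul, ← Finset.mul_sum, hsum,
        Finset.sum_ite_eq, Finset.mem_univ, if_true]
      noncomm_ring
    have h2' : ∑ k, g k * star (g k) ≤ 1 := by
      rw [h2, sub_sub]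
      refine (sub_le_self _ (add_nonneg (star_mul_self_nonneg _) ?_)).trans hf1
      have := star_left_conjugate_nonneg hD0 (w j)
      exact this
    let z : Fin n → H →L[ℂ] H := fun k => D * m * g k
    have hzM : ∀ k, z k ∈ M := fun k => mul_mem (mul_mem hDM hm) (sub_mem (by
      split_ifs; exacts [hf, zero_mem M]) (mul_mem (star_mem (hwM j)) (hwM k)))
    have hzf : ∀ k, z k * f = z k := fun k => by
      simp only [z, g, mul_assoc, sub_mul, hwf, ite_mul, zero_mul, hff]
    have h3 : ∑ k, w k * star (z k) = D * (w j * star m) * D := by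
      simp only [z, star_mul, hDs.star_eq, ← mul_assoc, ← Finset.sum_mul]
      rw [h1]
    have h3' : ∑ k, z k * star (w k) = D * (m * star (w j)) * D := by
      have := congr(star $h3)
      simpa [star_sum, hDs.star_eq, mul_assoc] using this
    have h4 : ∑ k, z k * star (z k) = D * (m * (∑ k, g k * star (g k)) * star m) * D := by
      simp only [z, star_mul, hDs.star_eq, Finset.mul_sum, Finset.sum_mul, mul_assoc]
    have h4' : m * (∑ k, g k * star (g k)) * star m ≤ m * star m := by
      simpa using star_right_conjugate_le_conjugate h2' m
    have hwj := hwr.norm_le_one j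
    have h5 : ∀ s : H →L[ℂ] H, star s = s → ‖s‖ ≤ 2 / 3 → s + m * star m ≤ 1 := by
      intro s hs hsn
      have hsa : IsSelfAdjoint (s + m * star m) := by
        rw [IsSelfAdjoint, star_add, hs, star_mul, star_star]
      refine hsa.le_algebraMap_norm_self.trans ?_
      have : ‖s + m * star m‖ ≤ 1 := by
        refine (norm_add_le _ _).trans ?_
        rw [CStarRing.norm_self_mul_star]
        nlinarith [norm_nonneg m]
      simpa using algebraMap_mono (H →L[ℂ] H) this
    have hpm : ∀ s : ℂ, (s = 1 ∨ s = -1) → (fun k => w k + s • z k) ∈ rowBall M f n := by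
      intro s hs
      have hss : star s = s := by rcases hs with rfl | rfl <;> simp
      have hs2 : s * s = 1 := by rcases hs with rfl | rfl <;> simp
      refine ⟨fun k => add_mem (hwM k) (smul_mem_vN _ (hzM k)), fun k => by
        rw [add_mul, hwf, smul_mul_assoc, hzf], (rowContraction_iff _).2 ?_⟩
      have e : ∑ k, (w k + s • z k) * star (w k + s • z k) = ∑ k, w k * star (w k)
          + s • (∑ k, w k * star (z k)) + s • (∑ k, z k * star (w k)) + ∑ k, z k * star (z k) := by
        simp only [Finset.smul_sum, ← Finset.sum_add_distrib]
        refine Finset.sum_congr rfl fun k _ => ?_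
        simp only [star_add, star_smul, hss, add_mul, mul_add, smul_mul_assoc, mul_smul_comm,
          smul_add, smul_smul, hs2, one_smul]
        abel
      set S := s • (w j * star m + m * star (w j)) with hS
      have e2 : ∑ k, (w k + s • z k) * star (w k + s • z k)
          = 1 - D + D * (S + m * (∑ k, g k * star (g k)) * star m) * D := by
        rw [e, hsum, h3, h3', h4, hS]
        simp only [mul_add, add_mul, smul_add, mul_smul_comm, smul_mul_assoc]
        abel
      have h6 : S + m * (∑ k, g k * star (g k)) * star m ≤ 1 := by
        refine (add_le_add_right h4' S).trans (h5 S ?_ ?_)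
        · simp [hS, star_smul, hss, add_comm]
        · have hsn : ‖s‖ = 1 := by rcases hs with rfl | rfl <;> simp
          rw [hS, norm_smul, hsn, one_mul]
          refine (norm_add_le _ _).trans ?_
          have := norm_mul_le (w j) (star m)
          have := norm_mul_le m (star (w j))
          rw [norm_star] at *
          nlinarith [norm_nonneg m, norm_nonneg (w j)]
      rw [e2]
      have h7 : D * (S + m * (∑ k, g k * star (g k)) * star m) * D ≤ D * D := by
        simpa using IsSelfAdjoint.conjugate_le_conjugate (c := D) h6 hDs
      calc _ ≤ 1 - D + D := add_le_add_right (h7.trans hDD) _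
        _ = 1 := by abel
    have hz := hext z (by simpa using hpm 1 (.inl rfl)) (by
      simpa [sub_eq_add_neg] using hpm (-1) (.inr rfl)) j
    simpa [z, g] using hz
  by_cases hD' : D = 0
  · left
    rw [hD, sub_eq_zero] at hD'
    exact hD'.symm
  · right
    intro j
    have := factor_mul_eq_zero hM (a := D) (b := f - star (w j) * w j) hDM fun m hm => by
      by_cases hm0 : m = 0
      · simp [hm0]
      have hn : ‖m‖ ≠ 0 := norm_ne_zero_iff.2 hm0
      have := main j (((3 * ‖m‖ : ℝ)⁻¹ : ℂ) • m) (smul_mem_vN _ hm) (by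
        rw [norm_smul]
        simp
        field_simp
        rfl)
      rw [mul_smul_comm, smul_mul_assoc, smul_eq_zero] at this
      refine this.resolve_left ?_
      simp [hn]
    rcases this with h | h
    · exact absurd h hD'
    · exact (sub_eq_zero.1 h).symm

end Row

theorem IsTrace.exists_vectors (hT : IsTrace M T) [Nontrivial H]
    (hM : ∀ x ∈ M, (∀ y ∈ M, x * y = y * x) → ∃ c : ℂ, x = c • 1) :
    ∃ (n : ℕ) (η ζ : Fin n → H), ∀ x ∈ M, T x = ∑ k, ⟪η k, x (ζ k)⟫_ℂ := by
  obtain ⟨f, hf, hfp, hf0, η, ζ, h⟩ := hT.exists_local_vector_projection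
  have hfs : star f = f := hfp.isSelfAdjoint
  have hff : f * f = f := hfp.isIdempotentElem
  have hTf : 0 < (T f).re := lt_of_le_of_ne (hT.re_nonneg hf hfp.nonneg) fun h0 => hf0
    (hT.eq_zero hf hfp.nonneg (Complex.ext h0.symm (hT.im_eq_zero hf hfs)))
  obtain ⟨n, hn⟩ := exists_nat_gt ((T f).re)⁻¹
  obtain ⟨w, hw, hext⟩ := exists_extreme_row M f n
  have h1 : ∑ k, w k * star (w k) = 1 := by
    refine (extreme_row_dichotomy hf hfp hM hw hext).resolve_right fun h2 => ?_
    have h3 := hT.re_mono (sum_mem fun k _ => mul_mem (hw.1 k) (star_mem (hw.1 k)))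
      (one_mem M) ((rowContraction_iff w).1 hw.2.2)
    have h4 : ∀ k, T (w k * star (w k)) = T f := fun k => by
      rw [hT.comm _ (hw.1 k) _ (star_mem (hw.1 k)), h2]
    simp only [map_sum, h4, hT.one, Finset.sum_const, Finset.card_univ, Fintype.card_fin,
      Complex.one_re, nsmul_eq_mul] at h3
    simp only [Complex.mul_re, Complex.natCast_re, Complex.natCast_im, zero_mul, sub_zero] at h3
    rw [inv_lt_iff_one_lt_mul₀ hTf] at hn
    linarith
  refine ⟨n, fun k => w k η, fun k => w k ζ, fun x hx => ?_⟩
  calc T x = T (∑ k, x * (w k * star (w k))) := by rw [← Finset.mul_sum, h1, mul_one]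
    _ = ∑ k, T (f * (star (w k) * x * w k)) := by
      rw [map_sum]
      refine Finset.sum_congr rfl fun k _ => ?_
      have e : f * (star (w k) * x * w k) = (f * star (w k)) * (x * w k) := by
        simp only [mul_assoc]
      have e2 : f * star (w k) = star (w k) := by
        have := congr(star $(hw.2.1 k))
        rwa [star_mul, hfs] at this
      rw [e, e2, hT.comm _ (star_mem (hw.1 k)) _ (mul_mem hx (hw.1 k)), mul_assoc]
    _ = _ := by
      refine Finset.sum_congr rfl fun k _ => ?_
      rw [h _ (mul_mem (mul_mem (star_mem (hw.1 k)) hx) (hw.1 k)),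
        ← ContinuousLinearMap.adjoint_inner_right]
      rfl

/-- The trace of a factor is continuous along weakly convergent families. -/
theorem IsTrace.tendsto (hT : IsTrace M T) [Nontrivial H]
    (hM : ∀ x ∈ M, (∀ y ∈ M, x * y = y * x) → ∃ c : ℂ, x = c • 1)
    {ι : Type*} {l : Filter ι} {x : ι → H →L[ℂ] H} {x₀ : H →L[ℂ] H} (h : WOTLim l x x₀)
    (hx : ∀ i, x i ∈ M) (hx₀ : x₀ ∈ M) : Tendsto (fun i => T (x i)) l (𝓝 (T x₀)) := by
  obtain ⟨n, η, ζ, hv⟩ := hT.exists_vectors hM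
  simp only [hv _ (hx _), hv _ hx₀]
  exact tendsto_finsetSum _ fun k _ => h _ _

end

section

variable {M A B : VonNeumannAlgebra H} {T : (H →L[ℂ] H) →ₗ[ℂ] ℂ}
  {E : (H →L[ℂ] H) →ₗ[ℂ] (H →L[ℂ] H)}

section Density

theorem sum_range_clamp (s : ℝ) (hs : 0 ≤ s) (m : ℕ) :
    ∑ k ∈ Finset.range m, max (s - k) 0 * (max (s - k) 1)⁻¹ = min (m : ℝ) s := by
  induction m with
  | zero => simp [hs]
  | succ m ih =>
    rw [Finset.sum_range_succ, ih]
    push_cast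
    rcases le_total s m with h | h
    · rw [min_eq_right h, min_eq_right (by linarith), max_eq_right (by linarith)]; ring
    · rw [min_eq_left h, max_eq_left (by linarith)]
      rcases le_total s (m + 1) with h' | h'
      · rw [min_eq_right h', max_eq_right (by linarith)]; ring
      · rw [min_eq_left h', max_eq_left (by linarith), mul_inv_cancel₀ (by linarith)]

/-- A projection of `A` below and a projection above a spectral truncation. -/
theorem exists_spectral_projection {a : H →L[ℂ] H} (ha : a ∈ A) (k : ℝ) :
    ∃ e ∈ A, IsStarProjection e ∧
      cfc (fun t : ℝ => max (t - k) 0 * (max (t - k) 1)⁻¹) a ≤ e ∧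
      e ≤ cfc (fun t : ℝ => max (t - (k - 1)) 0 * (max (t - (k - 1)) 1)⁻¹) a := by
  have hcont : ∀ k : ℝ, Continuous fun t : ℝ => (max (t - k) 1)⁻¹ := fun k =>
    ((continuous_id.sub continuous_const).max continuous_const).inv₀
      fun t => (lt_max_of_lt_right one_pos).ne'
  have hcont2 : ∀ k : ℝ, Continuous fun t : ℝ => max (t - k) 0 * (max (t - k) 1)⁻¹ := fun k =>
    (by fun_prop : Continuous fun t : ℝ => max (t - k) 0).mul (hcont k)
  have hle : ∀ k t : ℝ, max (t - k) 0 * (max (t - k) 1)⁻¹ ≤ 1 := fun k t => by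
    rw [← div_eq_mul_inv, div_le_one (lt_max_of_lt_right one_pos)]
    exact max_le_max le_rfl zero_le_one
  have hge : ∀ k t : ℝ, 0 ≤ max (t - k) 0 * (max (t - k) 1)⁻¹ := fun k t => by positivity
  obtain ⟨e, he, hep, h1, h2⟩ := exists_support (cfc_mem (M := A) ha (fun t : ℝ => max (t - k) 0))
  set c := cfc (fun t : ℝ => max (t - k) 0) a with hc
  have hes : star e = e := hep.isSelfAdjoint
  refine ⟨e, he, hep, ?_, ?_⟩
  · set g := cfc (fun t : ℝ => max (t - k) 0 * (max (t - k) 1)⁻¹) a with hg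
    have hgs : star g = g := cfc_predicate (p := IsSelfAdjoint) _ a
    have hg' : g = cfc (fun t : ℝ => (max (t - k) 1)⁻¹) a * c := by
      rw [hc, ← cfc_mul (fun t : ℝ => (max (t - k) 1)⁻¹) (fun t : ℝ => max (t - k) 0) a
        (hcont k).continuousOn (by fun_prop), hg]
      exact cfc_congr fun t _ => mul_comm _ _
    have hge' : g * e = g := h1 g fun ξ hξ => by
      rw [hg', mul_apply_eq_comp, hξ, map_zero]
    have heg : e * g = g := by
      have := congr(star $hge')
      rwa [star_mul, hes, hgs] at this
    have hg1 : g ≤ 1 := cfc_le_one _ _ fun t _ => hle k t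
    have := hep.isSelfAdjoint.conjugate_le_conjugate hg1
    rwa [heg, hge', mul_one, hep.isIdempotentElem.eq] at this
  · set g := cfc (fun t : ℝ => max (t - (k - 1)) 0 * (max (t - (k - 1)) 1)⁻¹) a with hg
    have hgs : star g = g := cfc_predicate (p := IsSelfAdjoint) _ a
    have hcg : c * g = c := by
      rw [hc, hg, ← cfc_mul (fun t : ℝ => max (t - k) 0) _ a (by fun_prop)
        (hcont2 (k - 1)).continuousOn]
      refine cfc_congr fun t _ => ?_
      rcases le_total t k with h | h
      · simp [h]
      · have h1 : (1 : ℝ) ≤ t - (k - 1) := by linarith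
        rw [max_eq_left (a := t - (k - 1)) (by linarith), max_eq_left h1,
          mul_inv_cancel₀ (by linarith), mul_one]
    have heg : e * g = e := by
      have := h2 (g - 1) (by rw [mul_sub, hcg, mul_one, sub_self])
      rwa [mul_sub, mul_one, sub_eq_zero] at this
    have hge' : g * e = e := by
      have := congr(star $heg)
      rwa [star_mul, hes, hgs] at this
    have hg0 : 0 ≤ g := cfc_nonneg fun t _ => hge _ t
    have := IsSelfAdjoint.conjugate_nonneg (c := 1 - e) hg0 ((IsSelfAdjoint.one _).sub hes)
    have e1 : (1 - e) * g * (1 - e) = g - e := by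
      simp only [sub_mul, mul_sub, one_mul, mul_one, heg, hge', hep.isIdempotentElem.eq]
      abel
    rw [e1] at this
    exact sub_nonneg.1 this

variable [Nontrivial H] {t : H →L[ℂ] H}

theorem norm_commutator_le (ht : ∀ p ∈ A, IsStarProjection p → t * p = p * t) {a : H →L[ℂ] H}
    (ha : a ∈ A) (h0 : 0 ≤ a) : ‖t * a - a * t‖ ≤ 2 * ‖t‖ := by
  have hsa : IsSelfAdjoint a := .of_nonneg h0
  obtain ⟨m, hm⟩ := exists_nat_ge ‖a‖
  choose e heA hep he1 he2 using fun k : ℕ => exists_spectral_projection ha (k : ℝ)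
  set g : ℕ → H →L[ℂ] H := fun k => cfc (fun t : ℝ => max (t - k) 0 * (max (t - k) 1)⁻¹) a with hg
  have hcont : ∀ k : ℕ, Continuous fun t : ℝ => max (t - k) 0 * (max (t - k) 1)⁻¹ := fun k =>
    (by fun_prop : Continuous fun t : ℝ => max (t - k) 0).mul
    (((continuous_id.sub continuous_const).max continuous_const).inv₀
      fun t => (lt_max_of_lt_right one_pos).ne')
  have hsum : ∑ k ∈ Finset.range m, g k = a := by
    rw [hg, ← cfc_sum _ a _ fun k _ => (hcont k).continuousOn]
    conv_rhs => rw [← cfc_id' ℝ a]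
    refine cfc_congr fun t ht => ?_
    have h1 := spectrum_nonneg_of_nonneg h0 ht
    have h2 : t ≤ m := (le_abs_self t).trans ((spectrum.norm_le_norm_of_mem ht).trans hm)
    rw [Finset.sum_apply, sum_range_clamp t h1, min_eq_right h2]
  have hle : ∀ k, e (k + 1) ≤ g k := fun k => by simpa [hg] using he2 (k + 1)
  set s := ∑ k ∈ Finset.range m, e (k + 1) with hs
  have h1 : 0 ≤ a - s := by
    rw [sub_nonneg, ← hsum]
    exact Finset.sum_le_sum fun k _ => hle k
  have h2 : a - s ≤ 1 := by
    have : a - s ≤ ∑ k ∈ Finset.range m, (e k - e (k + 1)) := by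
      rw [Finset.sum_sub_distrib, ← hs]
      gcongr
      rw [← hsum]
      exact Finset.sum_le_sum fun k _ => he1 k
    rw [Finset.sum_range_sub'] at this
    exact (this.trans (sub_le_self _ (hep m).nonneg)).trans (hep 0).le_one
  have h3 : ‖a - s‖ ≤ 1 := (CStarAlgebra.norm_le_one_iff_of_nonneg _ h1).2 h2
  have h4 : t * s = s * t := by
    rw [hs, Finset.mul_sum, Finset.sum_mul]
    exact Finset.sum_congr rfl fun k _ => ht _ (heA _) (hep _)
  have h5 : t * a - a * t = t * (a - s) - (a - s) * t := by
    rw [mul_sub, sub_mul, h4]; abel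
  rw [h5]
  refine (norm_sub_le _ _).trans ?_
  have := norm_mul_le t (a - s)
  have := norm_mul_le (a - s) t
  nlinarith [norm_nonneg t]

/-- An operator commuting with the projections of `A` commutes with `A`. -/
theorem commute_of_commute_projections (ht : ∀ p ∈ A, IsStarProjection p → t * p = p * t)
    {a : H →L[ℂ] H} (ha : a ∈ A) : t * a = a * t := by
  have hpos : ∀ a ∈ A, 0 ≤ a → t * a = a * t := by
    intro a ha h0
    rw [← sub_eq_zero, ← norm_le_zero_iff]
    by_contra! hlt
    obtain ⟨N, hN⟩ := exists_nat_gt (2 * ‖t‖ / ‖t * a - a * t‖)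
    rw [div_lt_iff₀ hlt] at hN
    have := norm_commutator_le ht (nsmul_mem ha N) (nsmul_nonneg h0 N)
    rw [mul_smul_comm, smul_mul_assoc, ← nsmul_sub, ← Nat.cast_smul_eq_nsmul ℂ, norm_smul] at this
    simp at this
    linarith
  have hsa : ∀ a ∈ A, IsSelfAdjoint a → t * a = a * t := by
    intro a ha hs
    have h1 : 0 ≤ (‖a‖ : ℂ) • (1 : H →L[ℂ] H) + a := by
      have := hs.neg_algebraMap_norm_le_self
      rw [neg_le_iff_add_nonneg'] at this
      simpa [Algebra.algebraMap_eq_smul_one] using this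
    have := hpos _ (add_mem (smul_mem_vN _ (one_mem A)) ha) h1
    simpa [mul_add, add_mul] using this
  have h1 := hsa _ (add_mem ha (star_mem ha)) (IsSelfAdjoint.add_star_self a)
  have h2 := hsa (Complex.I • (a - star a)) (smul_mem_vN _ (sub_mem ha (star_mem ha))) (by
    rw [IsSelfAdjoint, star_smul, star_sub, star_star]
    simp [smul_sub]
    abel)
  rw [mul_smul_comm, smul_mul_assoc] at h2
  have h3 := smul_right_injective _ Complex.I_ne_zero h2
  have h4 : (2 : ℂ) • (t * a) = (2 : ℂ) • (a * t) := by
    rw [two_smul, two_smul]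
    have e1 : t * a + t * a = t * (a + star a) + t * (a - star a) := by noncomm_ring
    have e2 : a * t + a * t = (a + star a) * t + (a - star a) * t := by noncomm_ring
    rw [e1, e2, h1, h3]
  exact smul_right_injective _ two_ne_zero h4

theorem le_of_projections (h : ∀ p ∈ A, IsStarProjection p → p ∈ B) {a : H →L[ℂ] H} (ha : a ∈ A) :
    a ∈ B := by
  rw [← B.commutant_commutant, VonNeumannAlgebra.mem_commutant_iff]
  intro c hc
  rw [VonNeumannAlgebra.mem_commutant_iff] at hc
  exact commute_of_commute_projections (fun p hp hpp => (hc p (h p hp hpp)).symm) ha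

end Density

/-- `E` restricts to the trace-preserving conditional expectation of `M` onto `B`. -/
structure IsExp (M B : VonNeumannAlgebra H) (T : (H →L[ℂ] H) →ₗ[ℂ] ℂ)
    (E : (H →L[ℂ] H) →ₗ[ℂ] (H →L[ℂ] H)) : Prop where
  sub : ∀ x ∈ B, x ∈ M
  mem : ∀ x ∈ M, E x ∈ B
  orth : ∀ x ∈ M, ∀ b ∈ B, T ((x - E x) * b) = 0

namespace IsExp

variable (hT : IsTrace M T) (hE : IsExp M B T E)
include hT hE

theorem eq_of_orth {x y : H →L[ℂ] H} (hx : x ∈ M) (hy : y ∈ B)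
    (h : ∀ b ∈ B, T ((x - y) * b) = 0) : E x = y := by
  have hm : E x - y ∈ B := sub_mem (hE.mem x hx) hy
  have h1 : T (star (E x - y) * (E x - y)) = 0 := by
    rw [hT.comm _ (star_mem (hE.sub _ hm)) _ (hE.sub _ hm)]
    have e : (E x - y) * star (E x - y) = (x - y) * star (E x - y) - (x - E x) * star (E x - y) := by
      noncomm_ring
    rw [e, map_sub, h _ (star_mem hm), hE.orth x hx _ (star_mem hm), sub_zero]
  exact sub_eq_zero.1 (hT.faithful _ (hE.sub _ hm) h1)

theorem apply_mem {b : H →L[ℂ] H} (hb : b ∈ B) : E b = b :=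
  hE.eq_of_orth hT (hE.sub b hb) hb fun c _ => by simp

omit hT in
theorem trace_mul {x b : H →L[ℂ] H} (hx : x ∈ M) (hb : b ∈ B) : T (E x * b) = T (x * b) := by
  have := hE.orth x hx b hb
  rw [sub_mul, map_sub, sub_eq_zero] at this
  exact this.symm

omit hT in
theorem trace_apply {x : H →L[ℂ] H} (hx : x ∈ M) : T (E x) = T x := by
  simpa using hE.trace_mul hx (one_mem B)

theorem star_apply {x : H →L[ℂ] H} (hx : x ∈ M) : E (star x) = star (E x) :=
  hE.eq_of_orth hT (star_mem hx) (star_mem (hE.mem x hx)) fun c hc => by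
    have hd : x - E x ∈ M := sub_mem hx (hE.sub _ (hE.mem x hx))
    have e : (star x - star (E x)) * c = star (star c * (x - E x)) := by simp
    rw [e, hT.star_apply (mul_mem (star_mem (hE.sub c hc)) hd),
      hT.comm _ (star_mem (hE.sub c hc)) _ hd, hE.orth x hx _ (star_mem hc), star_zero]

theorem nonneg {x : H →L[ℂ] H} (hx : x ∈ M) (h0 : 0 ≤ x) : 0 ≤ E x := by
  set a := E x with ha
  have haB : a ∈ B := hE.mem x hx
  have hs : IsSelfAdjoint a := by
    rw [IsSelfAdjoint, ha, ← hE.star_apply hT hx, (IsSelfAdjoint.of_nonneg h0).star_eq]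
  set p := cfc (fun t : ℝ => max (-t) 0) a with hp
  have hpB : p ∈ B := cfc_mem haB _
  have hp0 : 0 ≤ p := cfc_nonneg fun t _ => le_max_right _ _
  have hap : a * p = -(p * p) := by
    have : a * p = cfc (fun t : ℝ => t * max (-t) 0) a := by
      rw [cfc_mul (fun t : ℝ => t) (fun t : ℝ => max (-t) 0) a, cfc_id' ℝ a]
    rw [this, hp, ← cfc_mul _ _ a, ← cfc_neg]
    refine cfc_congr fun t _ => ?_
    rcases le_total t 0 with h | h <;> simp [h]
  have hpz : p = 0 := by
    have h1 : 0 ≤ (T (x * p)).re := by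
      obtain ⟨c, hc, -, hcs, hcc⟩ := exists_sqrt hpB hp0
      have hcM := hE.sub c hc
      have e : T (x * p) = T (c * x * c) := by
        rw [← hcc, ← mul_assoc, hT.comm _ (mul_mem hx hcM) _ hcM, mul_assoc]
      rw [e]
      exact hT.re_nonneg (mul_mem (mul_mem hcM hx) hcM)
        (IsSelfAdjoint.conjugate_nonneg (c := c) h0 hcs)
    rw [← hE.trace_mul hx hpB, ← ha, hap, map_neg, Complex.neg_re] at h1
    have hps : star p = p := (IsSelfAdjoint.of_nonneg hp0)
    have hpM := hE.sub p hpB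
    refine hT.faithful p hpM ?_
    have h2 := Complex.nonneg_iff.1 (hT.nonneg_star p hpM)
    rw [hps] at h2 ⊢
    exact Complex.ext (by simpa using (by linarith [h2.1] : (T (p * p)).re = 0)) h2.2.symm
  have hap' : a + p = cfc (fun t : ℝ => max t 0) a := by
    have h1 := cfc_add a (fun t : ℝ => t) (fun t : ℝ => max (-t) 0)
    rw [cfc_id' ℝ a] at h1
    rw [hp, ← h1]
    refine cfc_congr fun t _ => ?_
    rcases le_total t 0 with h | h <;> simp [h]
  rw [hpz, add_zero] at hap'
  rw [hap']
  exact cfc_nonneg fun t _ => le_max_right _ _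

theorem mono {x y : H →L[ℂ] H} (hx : x ∈ M) (hy : y ∈ M) (h : x ≤ y) : E x ≤ E y := by
  have := hE.nonneg hT (sub_mem hy hx) (sub_nonneg.2 h)
  rwa [map_sub, sub_nonneg] at this

/-- Pythagoras for a conditional expectation. -/
theorem norm_sub_sq {x : H →L[ℂ] H} (hx : x ∈ M) :
    T (star (x - E x) * (x - E x)) = T (star x * x) - T (star (E x) * E x) := by
  have hB := hE.mem x hx
  have h1 := hE.orth x hx (star (E x)) (star_mem hB)
  have hsM := star_mem (hE.sub _ hB)
  have hdM : x - E x ∈ M := sub_mem hx (hE.sub _ hB)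
  rw [hT.comm _ hdM _ hsM, mul_sub, map_sub, sub_eq_zero] at h1
  have h2 := hE.trace_mul (star_mem hx) hB
  rw [hE.star_apply hT hx] at h2
  simp only [star_sub, sub_mul, mul_sub, map_sub, h1, h2]
  ring

theorem re_trace_le {x : H →L[ℂ] H} (hx : x ∈ M) :
    (T (star (E x) * E x)).re ≤ (T (star x * x)).re := by
  have h1 := congr(($(hE.norm_sub_sq hT hx)).re)
  have h2 := (Complex.nonneg_iff.1
    (hT.nonneg_star _ (sub_mem hx (hE.sub _ (hE.mem x hx))))).1
  rw [h1, Complex.sub_re] at h2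
  linarith

end IsExp

section PosPart

/-- The positive part of a self-adjoint operator. -/
def pos (a : H →L[ℂ] H) : H →L[ℂ] H := cfc (fun t : ℝ => max t 0) a

variable {a b : H →L[ℂ] H}

theorem pos_mem (ha : a ∈ A) : pos a ∈ A := cfc_mem ha _

theorem pos_nonneg (a : H →L[ℂ] H) : 0 ≤ pos a := cfc_nonneg fun _ _ => le_max_right _ _

theorem star_pos (a : H →L[ℂ] H) : star (pos a) = pos a := IsSelfAdjoint.of_nonneg (pos_nonneg a)

theorem pos_mul_self (ha : IsSelfAdjoint a) : pos a * a = pos a * pos a := by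
  have h := cfc_mul (fun t : ℝ => max t 0) (fun t : ℝ => t) a
  rw [cfc_id' ℝ a] at h
  rw [pos, ← h, ← cfc_mul _ _ a]
  refine cfc_congr fun t _ => ?_
  rcases le_total t 0 with h | h <;> simp [h]

theorem le_pos (ha : IsSelfAdjoint a) : a ≤ pos a := by
  conv_lhs => rw [← cfc_id' ℝ a]
  exact cfc_mono fun t _ => le_max_left _ _

theorem pos_le [Nontrivial H] (ha : IsSelfAdjoint a) : pos a ≤ (‖a‖ : ℂ) • 1 := by
  have := cfc_le_algebraMap (fun t : ℝ => max t 0) ‖a‖ a fun t ht =>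
    max_le ((le_abs_self t).trans (spectrum.norm_le_norm_of_mem ht)) (norm_nonneg a)
  simpa [pos, Algebra.algebraMap_eq_smul_one] using this

theorem pos_mul_pos_neg (ha : IsSelfAdjoint a) : pos a * pos (-a) = 0 := by
  have h : pos (-a) = cfc (fun t : ℝ => max (-t) 0) a := by
    rw [pos, ← cfc_comp_neg (fun t : ℝ => max t 0) a]
  rw [h, pos, ← cfc_mul _ _ a, ← cfc_zero ℝ a]
  refine cfc_congr fun t _ => ?_
  rcases le_total t 0 with h | h <;> simp [h]

theorem mul_nonneg_of_comm (hcomm : ∀ a ∈ A, ∀ b ∈ A, a * b = b * a) (ha : a ∈ A) (hb : b ∈ A)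
    (ha0 : 0 ≤ a) (hb0 : 0 ≤ b) : 0 ≤ a * b := by
  obtain ⟨c, hc, -, hcs, rfl⟩ := exists_sqrt hb hb0
  rw [← mul_assoc, hcomm a ha c hc]
  exact IsSelfAdjoint.conjugate_nonneg (c := c) ha0 hcs

theorem mul_le_mul_of_comm (hcomm : ∀ a ∈ A, ∀ b ∈ A, a * b = b * a) {c : H →L[ℂ] H}
    (ha : a ∈ A) (hb : b ∈ A) (hc : c ∈ A) (hab : a ≤ b) (hc0 : 0 ≤ c) : c * a ≤ c * b := by
  rw [← sub_nonneg, ← mul_sub]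
  exact mul_nonneg_of_comm hcomm hc (sub_mem hb ha) hc0 (sub_nonneg.2 hab)

end PosPart

/-- A finite partition of unity by projections of `A`. -/
structure Part (A : VonNeumannAlgebra H) where
  ι : Type
  [fin : Fintype ι]
  e : ι → H →L[ℂ] H
  mem : ∀ i, e i ∈ A
  proj : ∀ i, IsStarProjection (e i)
  orth : ∀ i j, i ≠ j → e i * e j = 0
  sum : ∑ i, e i = 1

attribute [instance] Part.fin

namespace Part

/-- The projection `p` is a sum of pieces of the partition. -/
def Refines (P : Part A) (p : H →L[ℂ] H) : Prop := ∀ i, P.e i * p = P.e i ∨ P.e i * p = 0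

instance : Preorder (Part A) where
  le P Q := ∀ p ∈ A, IsStarProjection p → P.Refines p → Q.Refines p
  le_refl _ _ _ _ h := h
  le_trans _ _ _ h h' p hp hpp hr := h' p hp hpp (h p hp hpp hr)

theorem isStarProjection_mul {p q : H →L[ℂ] H} (hp : IsStarProjection p) (hq : IsStarProjection q)
    (h : p * q = q * p) : IsStarProjection (p * q) := by
  refine ⟨?_, ?_⟩
  · change p * q * (p * q) = p * q
    rw [mul_assoc, ← mul_assoc q, ← h, mul_assoc p, hq.isIdempotentElem.eq, ← mul_assoc,
      hp.isIdempotentElem.eq]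
  · rw [IsSelfAdjoint, star_mul, hp.isSelfAdjoint.star_eq, hq.isSelfAdjoint.star_eq, h]

/-- Refine each piece of a partition by its own partition. -/
def glue (hcomm : ∀ a ∈ A, ∀ b ∈ A, a * b = b * a) (P : Part A) (Q : P.ι → Part A) : Part A where
  ι := Σ i, (Q i).ι
  e x := P.e x.1 * (Q x.1).e x.2
  mem x := mul_mem (P.mem _) ((Q _).mem _)
  proj x := isStarProjection_mul (P.proj _) ((Q _).proj _) (hcomm _ (P.mem _) _ ((Q _).mem _))
  orth := by
    rintro ⟨i, k⟩ ⟨j, l⟩ h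
    by_cases hij : i = j
    · subst hij
      have hkl : k ≠ l := fun h' => h (by rw [h'])
      have e : P.e i * (Q i).e k * (P.e i * (Q i).e l) = P.e i * P.e i * ((Q i).e k * (Q i).e l) := by
        rw [mul_assoc, ← mul_assoc ((Q i).e k), hcomm _ ((Q i).mem k) _ (P.mem i)]
        simp only [mul_assoc]
      change P.e i * (Q i).e k * (P.e i * (Q i).e l) = 0
      rw [e, (Q i).orth k l hkl, mul_zero]
    · have e : P.e i * (Q i).e k * (P.e j * (Q j).e l) = P.e i * P.e j * ((Q i).e k * (Q j).e l) := by
        rw [mul_assoc, ← mul_assoc ((Q i).e k), hcomm _ ((Q i).mem k) _ (P.mem j)]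
        simp only [mul_assoc]
      change P.e i * (Q i).e k * (P.e j * (Q j).e l) = 0
      rw [e, P.orth i j hij, zero_mul]
  sum := by
    rw [Fintype.sum_sigma]
    simp only [← Finset.mul_sum, Part.sum, mul_one]

theorem le_glue (hcomm : ∀ a ∈ A, ∀ b ∈ A, a * b = b * a) (P Q : Part A) :
    P ≤ glue hcomm P (fun _ => Q) ∧ Q ≤ glue hcomm P (fun _ => Q) := by
  constructor
  · rintro p hp - h ⟨i, j⟩
    have e : P.e i * Q.e j * p = P.e i * p * Q.e j := by
      rw [mul_assoc, hcomm _ (Q.mem j) _ hp, mul_assoc]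
    change P.e i * Q.e j * p = P.e i * Q.e j ∨ P.e i * Q.e j * p = 0
    rw [e]
    exact (h i).imp (fun h => by rw [h]) (fun h => by rw [h, zero_mul])
  · rintro p - - h ⟨i, j⟩
    change P.e i * Q.e j * p = P.e i * Q.e j ∨ P.e i * Q.e j * p = 0
    rw [mul_assoc]
    exact (h j).imp (fun h => by rw [h]) (fun h => by rw [h, mul_zero])

/-- The partition `{p, 1 - p}`. -/
def two {p : H →L[ℂ] H} (hp : p ∈ A) (hpp : IsStarProjection p) : Part A where
  ι := Bool
  e b := if b then p else 1 - p
  mem b := by cases b <;> simp [hp, sub_mem (one_mem A) hp]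
  proj b := by cases b <;> simp [hpp, hpp.one_sub]
  orth := by
    have := hpp.isIdempotentElem.eq
    rintro (_ | _) (_ | _) h <;> simp [sub_mul, mul_sub, this] at h ⊢
  sum := by simp

theorem two_refines {p : H →L[ℂ] H} (hp : p ∈ A) (hpp : IsStarProjection p) :
    (two hp hpp).Refines p := by
  have := hpp.isIdempotentElem.eq
  rintro (_ | _) <;> simp [two, sub_mul, this]

instance : Nonempty (Part A) := ⟨two (one_mem A) (IsStarProjection.one _)⟩

theorem exists_ultrafilter (hcomm : ∀ a ∈ A, ∀ b ∈ A, a * b = b * a) :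
    ∃ l : Ultrafilter (Part A), ∀ p ∈ A, IsStarProjection p → ∀ᶠ P : Part A in l, P.Refines p := by
  have : IsDirectedOrder (Part A) := ⟨fun P Q => ⟨_, le_glue hcomm P Q⟩⟩
  refine ⟨Ultrafilter.of atTop, fun p hp hpp => ?_⟩
  exact Ultrafilter.of_le atTop ((eventually_ge_atTop (two hp hpp)).mono fun Q hQ =>
    hQ p hp hpp (two_refines hp hpp))

end Part

theorem pos_mul_eq_of_le (hcomm : ∀ a ∈ A, ∀ b ∈ A, a * b = b * a) {a b e : H →L[ℂ] H}
    (ha : a ∈ A) (has : IsSelfAdjoint a) (hbs : IsSelfAdjoint b) (hab : a ≤ b)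
    (he : e ∈ A) (hep : IsStarProjection e) (h : pos b * e = pos b) : pos a * e = pos a := by
  obtain ⟨t, ht⟩ : ∃ t, t = 1 - e := ⟨_, rfl⟩
  have htp : IsStarProjection t := ht ▸ hep.one_sub
  have htt : t * t = t := htp.isIdempotentElem.eq
  have hts : star t = t := htp.isSelfAdjoint.star_eq
  have hbt : pos b * t = 0 := by rw [ht, mul_sub, h, mul_one, sub_self]
  have hc : pos a * t = t * pos a := by
    rw [ht, mul_sub, sub_mul, mul_one, one_mul, hcomm _ (pos_mem ha) _ he]
  obtain ⟨X, hX⟩ : ∃ X, X = pos a * t := ⟨_, rfl⟩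
  have hX' : X = t * pos a := hX.trans hc
  have hXs : star X = X := by rw [hX, star_mul, star_pos, hts, hc]
  have hX0 : 0 ≤ X := by
    have : X = t * pos a * t := by rw [mul_assoc, hc, ← mul_assoc, htt, hX']
    rw [this]
    exact IsSelfAdjoint.conjugate_nonneg (pos_nonneg a) hts
  have h1 : X * a * X ≤ X * pos b * X := by
    simpa [hXs] using star_left_conjugate_le_conjugate (hab.trans (le_pos hbs)) X
  have h2 : X * pos b * X = 0 := by
    rw [mul_assoc]
    nth_rewrite 2 [hX']
    rw [← mul_assoc (pos b), hbt, zero_mul, mul_zero]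
  have h3 : X * a * X = X * X * X :=
    calc X * a * X = (t * pos a) * a * (t * pos a) := by rw [hX']
      _ = t * (pos a * a) * (t * pos a) := by noncomm_ring
      _ = (t * pos a) * (pos a * (t * t)) * pos a := by rw [pos_mul_self has, htt]; noncomm_ring
      _ = (t * pos a) * (pos a * t) * (t * pos a) := by noncomm_ring
      _ = X * X * X := by rw [← hX, ← hX']
  rw [h2, h3] at h1
  have h4 : 0 ≤ X * X * X := IsSelfAdjoint.conjugate_nonneg hX0 hXs
  have h5 := le_antisymm h1 h4
  have h6 : X * X = 0 := by
    rw [← CStarRing.star_mul_self_eq_zero_iff, star_mul, hXs, ← mul_assoc, h5, zero_mul]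
  have h7 : X = 0 := by rw [← CStarRing.star_mul_self_eq_zero_iff, hXs, h6]
  rw [hX, ht, mul_sub, mul_one, sub_eq_zero] at h7
  exact h7.symm

/-- The completely positive map `p ↦ E (y* p y)`. -/
def phi (E : (H →L[ℂ] H) →ₗ[ℂ] (H →L[ℂ] H)) (y p : H →L[ℂ] H) : H →L[ℂ] H := E (star y * p * y)

section phi

variable {y p q : H →L[ℂ] H}

theorem phi_sum {ι : Type*} (s : Finset ι) (f : ι → H →L[ℂ] H) :
    phi E y (∑ i ∈ s, f i) = ∑ i ∈ s, phi E y (f i) := by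
  simp [phi, Finset.mul_sum, Finset.sum_mul]

theorem phi_sub : phi E y (p - q) = phi E y p - phi E y q := by
  simp [phi, mul_sub, sub_mul]

variable (hT : IsTrace M T) (hE : IsExp M A T E) (hy : y ∈ M)

include hE hy in
theorem phi_mem (hp : p ∈ M) : phi E y p ∈ A :=
  hE.mem _ (mul_mem (mul_mem (star_mem hy) hp) hy)

include hT hE hy in
theorem phi_nonneg (hp : p ∈ M) (h0 : 0 ≤ p) : 0 ≤ phi E y p :=
  hE.nonneg hT (mul_mem (mul_mem (star_mem hy) hp) hy) (star_left_conjugate_nonneg h0 y)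

include hT hE hy in
theorem phi_mono (hp : p ∈ M) (hq : q ∈ M) (h : p ≤ q) : phi E y p ≤ phi E y q :=
  sub_nonneg.1 (phi_sub (E := E) ▸ phi_nonneg hT hE hy (sub_mem hq hp) (sub_nonneg.2 h))

theorem star_mul_self_le_norm [Nontrivial H] (y : H →L[ℂ] H) :
    star y * y ≤ ((‖y‖ ^ 2 : ℝ) : ℂ) • 1 := by
  have := CStarAlgebra.star_mul_le_algebraMap_norm_sq (a := y)
  rwa [Algebra.algebraMap_eq_smul_one, ← Complex.coe_smul] at this

include hT hE hy in
theorem phi_le [Nontrivial H] (hp : p ∈ M) (h1 : p ≤ 1) :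
    phi E y p ≤ ((‖y‖ ^ 2 : ℝ) : ℂ) • 1 := by
  have h := hE.mono hT (mul_mem (mul_mem (star_mem hy) hp) hy)
    (smul_mem_vN ((‖y‖ ^ 2 : ℝ) : ℂ) (one_mem M))
    ((show star y * p * y ≤ star y * y by
      simpa using star_left_conjugate_le_conjugate h1 y).trans (star_mul_self_le_norm y))
  rwa [map_smul, hE.apply_mem hT (one_mem A)] at h

theorem norm_le_of_le_smul_one [Nontrivial H] {x : H →L[ℂ] H} {c : ℝ} (h0 : 0 ≤ x) (hc : 0 ≤ c)
    (h : x ≤ (c : ℂ) • 1) : ‖x‖ ≤ c := by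
  refine (CStarAlgebra.norm_le_iff_le_algebraMap x hc h0).2 ?_
  simpa [Algebra.algebraMap_eq_smul_one] using h

include hT hE hy in
theorem norm_phi_le [Nontrivial H] (hp : p ∈ M) (h0 : 0 ≤ p) (h1 : p ≤ 1) :
    ‖phi E y p‖ ≤ ‖y‖ ^ 2 :=
  norm_le_of_le_smul_one (phi_nonneg hT hE hy hp h0) (by positivity) (phi_le hT hE hy hp h1)

/-- `∑ ‖E (y* e_i y)‖₂²` over the pieces of a partition, cut down by `r`. -/
def energy (T : (H →L[ℂ] H) →ₗ[ℂ] ℂ) (E : (H →L[ℂ] H) →ₗ[ℂ] (H →L[ℂ] H)) (y r : H →L[ℂ] H)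
    (P : Part A) : ℝ :=
  ∑ i, (T (phi E y (r * P.e i) * phi E y (r * P.e i))).re

include hT hE hy in
/-- Localise a lower bound on the energy to a single projection. -/
theorem exists_localization (hcomm : ∀ a ∈ A, ∀ b ∈ A, a * b = b * a) {c : ℝ} (hc : 0 < c)
    (h : ∀ P : Part A, c ≤ energy T E y 1 P) :
    ∃ r ∈ A, IsStarProjection r ∧ ∃ c' > 0, ∀ Q : Part A,
      (T (phi E y r * phi E y r)).re / 2 + c' ≤ energy T E y r Q := by
  have hbdd : BddBelow (Set.range (energy (A := A) T E y 1)) :=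
    ⟨c, by rintro _ ⟨P, rfl⟩; exact h P⟩
  obtain ⟨κ, hκ⟩ : ∃ κ, κ = ⨅ P : Part A, energy T E y 1 P := ⟨_, rfl⟩
  have hcκ : c ≤ κ := hκ ▸ le_ciInf h
  obtain ⟨P, hP⟩ := exists_lt_of_ciInf_lt (show ⨅ P : Part A, energy T E y 1 P < 2 * κ by
    rw [← hκ]; linarith)
  by_contra! hcon
  obtain ⟨n, hn⟩ : ∃ n : ℝ, n = (Fintype.card P.ι : ℝ) + 1 := ⟨_, rfl⟩
  have hn0 : 0 < n := by rw [hn]; positivity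
  choose Q hQ using fun i => hcon (P.e i) (P.mem i) (P.proj i) ((κ - energy T E y 1 P / 2) / n)
    (div_pos (by linarith) hn0)
  have h1 : energy T E y 1 (P.glue hcomm Q) = ∑ i, energy T E y (P.e i) (Q i) := by
    simp only [energy, one_mul]
    exact Fintype.sum_sigma _
  have h2 : ∑ i, energy T E y (P.e i) (Q i) ≤ ∑ i, ((T (phi E y (P.e i) * phi E y (P.e i))).re / 2 +
      (κ - energy T E y 1 P / 2) / n) := Finset.sum_le_sum fun i _ => (hQ i).le
  have h3 : ∑ i, ((T (phi E y (P.e i) * phi E y (P.e i))).re / 2 +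
      (κ - energy T E y 1 P / 2) / n) = energy T E y 1 P / 2 +
        (n - 1) * ((κ - energy T E y 1 P / 2) / n) := by
    rw [Finset.sum_add_distrib, ← Finset.sum_div, hn]
    simp [energy]
  have h4 : κ ≤ energy T E y 1 (P.glue hcomm Q) := hκ ▸ ciInf_le hbdd _
  have h5 : (n - 1) * ((κ - energy T E y 1 P / 2) / n) < κ - energy T E y 1 P / 2 := by
    rw [mul_div_assoc', div_lt_iff₀ hn0]
    nlinarith
  linarith

end phi

/-- The deviation of `phi E y p` from half of `phi E y r`. -/
def excess (E : (H →L[ℂ] H) →ₗ[ℂ] (H →L[ℂ] H)) (y r p : H →L[ℂ] H) : H →L[ℂ] H :=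
  phi E y p - (1 / 2 : ℂ) • phi E y r

/-- Approximants, along partitions of unity, of an operator that partially normalizes `A`. -/
def approx (E : (H →L[ℂ] H) →ₗ[ℂ] (H →L[ℂ] H)) (y r : H →L[ℂ] H) (Q : Part A) : H →L[ℂ] H :=
  ∑ j, r * Q.e j * y * pos (excess E y r (r * Q.e j))

section approx

variable {y r p : H →L[ℂ] H} (hT : IsTrace M T) (hE : IsExp M A T E) (hy : y ∈ M)
  (hcomm : ∀ a ∈ A, ∀ b ∈ A, a * b = b * a) (hr : r ∈ A) (hrp : IsStarProjection r)

include hE hy in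
theorem excess_mem (hr : r ∈ M) (hp : p ∈ M) : excess E y r p ∈ A :=
  sub_mem (phi_mem hE hy hp) (smul_mem_vN _ (phi_mem hE hy hr))

theorem proj_nonneg (hp : IsStarProjection p) : 0 ≤ p := by
  have := star_mul_self_nonneg p
  rwa [hp.isSelfAdjoint.star_eq, hp.isIdempotentElem.eq] at this

theorem proj_le_one (hp : IsStarProjection p) : p ≤ 1 :=
  sub_nonneg.1 (proj_nonneg hp.one_sub)

include hT hE hy in
theorem isSelfAdjoint_phi (hp : p ∈ M) (hpp : IsStarProjection p) : IsSelfAdjoint (phi E y p) :=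
  .of_nonneg (phi_nonneg hT hE hy hp (proj_nonneg hpp))

include hT hE hy in
theorem isSelfAdjoint_excess (hr : r ∈ M) (hrp : IsStarProjection r) (hp : p ∈ M)
    (hpp : IsStarProjection p) : IsSelfAdjoint (excess E y r p) := by
  have h1 := (isSelfAdjoint_phi hT hE hy hr hrp).star_eq
  have h2 := (isSelfAdjoint_phi hT hE hy hp hpp).star_eq
  simp [IsSelfAdjoint, excess, h1, h2]

include hT hE hy in
theorem excess_le (hr : r ∈ M) (hrp : IsStarProjection r) : excess E y r p ≤ phi E y p := by
  have h := phi_nonneg hT hE hy hr (proj_nonneg hrp)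
  rw [excess, sub_le_self_iff]
  exact smul_nonneg (by norm_num [Complex.nonneg_iff]) h

include hE hy hr in
theorem approx_mem (Q : Part A) : approx E y r Q ∈ M := by
  refine sum_mem fun j _ => ?_
  have h1 := hE.sub _ hr
  have h2 := hE.sub _ (Q.mem j)
  exact mul_mem (mul_mem (mul_mem h1 h2) hy)
    (hE.sub _ (pos_mem (excess_mem hE hy h1 (mul_mem h1 h2))))

include hT hE hy hcomm hr hrp in
theorem mul_approx_mul {Q : Part A} {e : H →L[ℂ] H} (hp : p ∈ A) (hpp : IsStarProjection p)
    (hQ : Q.Refines p) (he : e ∈ A) (hep : IsStarProjection e)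
    (h : pos (excess E y r (r * p)) * e = pos (excess E y r (r * p))) :
    p * approx E y r Q * e = p * approx E y r Q := by
  simp only [approx, Finset.mul_sum, Finset.sum_mul]
  refine Finset.sum_congr rfl fun j _ => ?_
  have hq := Q.mem j
  have hpr := Part.isStarProjection_mul hrp hpp (hcomm _ hr _ hp)
  have hqr := Part.isStarProjection_mul hrp (Q.proj j) (hcomm _ hr _ hq)
  have hrM := hE.sub _ hr
  have hpM := hE.sub _ hp
  have hqM := hE.sub _ hq
  obtain ⟨ψ, hψ⟩ : ∃ ψ, ψ = pos (excess E y r (r * Q.e j)) := ⟨_, rfl⟩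
  have e1 : p * (r * Q.e j * y * ψ) = r * (Q.e j * p) * y * ψ := by
    have : p * (r * Q.e j) = r * (Q.e j * p) := by
      rw [← mul_assoc, hcomm _ hp _ hr, mul_assoc, hcomm _ hp _ hq]
    rw [← this]; simp only [mul_assoc]
  rw [← hψ, e1]
  rcases hQ j with hj | hj
  · have hle : r * Q.e j ≤ r * p := by
      have h0 : r * p - r * Q.e j = r * (p * (1 - Q.e j)) := by
        rw [mul_sub, mul_one, hcomm _ hp _ hq, hj, mul_sub]
      have hpq := Part.isStarProjection_mul hpp (Q.proj j).one_sub
        (hcomm _ hp _ (sub_mem (one_mem A) hq))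
      rw [← sub_nonneg, h0]
      exact proj_nonneg (Part.isStarProjection_mul hrp hpq
        (hcomm _ hr _ (mul_mem hp (sub_mem (one_mem A) hq))))
    have hψe : ψ * e = ψ := by
      rw [hψ]
      refine pos_mul_eq_of_le hcomm (excess_mem hE hy hrM (mul_mem hrM hqM))
        (isSelfAdjoint_excess hT hE hy hrM hrp (mul_mem hrM hqM) hqr)
        (isSelfAdjoint_excess hT hE hy hrM hrp (mul_mem hrM hpM) hpr) ?_ he hep h
      exact sub_le_sub_right (phi_mono hT hE hy (mul_mem hrM hqM) (mul_mem hrM hpM) hle) _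
    rw [mul_assoc, hψe]
  · simp [hj]

set_option maxHeartbeats 800000 in
include hT hE hy hr hrp hcomm in
theorem norm_approx_le [Nontrivial H] (Q : Part A) :
    ‖approx E y r Q‖ ≤ 2 * (‖y‖ ^ 2) ^ 3 + 1 := by
  have hrM := hE.sub _ hr
  have hqM := fun j => hE.sub _ (Q.mem j)
  have hqr := fun j => Part.isStarProjection_mul hrp (Q.proj j) (hcomm _ hr _ (Q.mem j))
  have hqrM := fun j => mul_mem hrM (hqM j)
  obtain ⟨C, hC⟩ : ∃ C, C = ‖y‖ ^ 2 := ⟨_, rfl⟩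
  have hC0 : 0 ≤ C := hC ▸ by positivity
  have hC0' : (0 : ℂ) ≤ C := by exact_mod_cast hC0
  set ψ := fun j => pos (excess E y r (r * Q.e j)) with hψ
  have hψA : ∀ j, ψ j ∈ A := fun j => pos_mem (excess_mem hE hy hrM (hqrM j))
  have hψs : ∀ j, star (ψ j) = ψ j := fun j => star_pos _
  have hψle : ∀ j, ψ j ≤ ((2 * C : ℝ) : ℂ) • 1 := fun j => by
    refine (pos_le (isSelfAdjoint_excess hT hE hy hrM hrp (hqrM j) (hqr j))).trans ?_
    refine smul_le_smul_of_nonneg_right ?_ zero_le_one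
    norm_cast
    have h1 := norm_phi_le hT hE hy (hqrM j) (proj_nonneg (hqr j)) (proj_le_one (hqr j))
    have h2 := norm_phi_le hT hE hy hrM (proj_nonneg hrp) (proj_le_one hrp)
    refine (norm_sub_le _ _).trans ?_
    rw [norm_smul]
    norm_num
    rw [hC]
    nlinarith [sq_nonneg ‖y‖]
  have hx : ∀ j, star (r * Q.e j * y * ψ j) * (r * Q.e j * y * ψ j) ≤
      ((2 * C ^ 2 : ℝ) : ℂ) • phi E y (r * Q.e j) := fun j => by
    have e1 : star (r * Q.e j * y * ψ j) * (r * Q.e j * y * ψ j) =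
        star (ψ j) * (star y * (r * Q.e j) * y) * ψ j := by
      have : star (r * Q.e j) * (r * Q.e j) = r * Q.e j := by
        rw [(hqr j).isSelfAdjoint.star_eq, (hqr j).isIdempotentElem.eq]
      conv_rhs => rw [← this]
      simp only [star_mul, mul_assoc]
    have h1 : star y * (r * Q.e j) * y ≤ (C : ℂ) • 1 :=
      (show star y * (r * Q.e j) * y ≤ star y * y by
        simpa using star_left_conjugate_le_conjugate (proj_le_one (hqr j)) y).trans
        (hC ▸ star_mul_self_le_norm y)
    have h2 : star (ψ j) * (star y * (r * Q.e j) * y) * ψ j ≤ (C : ℂ) • (ψ j * ψ j) := by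
      simpa [hψs] using star_left_conjugate_le_conjugate h1 (ψ j)
    have hφA := phi_mem hE hy (hqrM j)
    have h3 : ψ j * ψ j ≤ ψ j * phi E y (r * Q.e j) := by
      rw [hψ, ← pos_mul_self (isSelfAdjoint_excess hT hE hy hrM hrp (hqrM j) (hqr j))]
      exact mul_le_mul_of_comm hcomm (excess_mem hE hy hrM (hqrM j)) hφA (hψA j)
        (excess_le hT hE hy hrM hrp) (pos_nonneg _)
    have h4 : ψ j * phi E y (r * Q.e j) ≤ ((2 * C : ℝ) : ℂ) • phi E y (r * Q.e j) := by
      rw [hcomm _ (hψA j) _ hφA]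
      simpa using mul_le_mul_of_comm hcomm (hψA j) (smul_mem_vN _ (one_mem A)) hφA (hψle j)
        (phi_nonneg hT hE hy (hqrM j) (proj_nonneg (hqr j)))
    rw [e1]
    refine h2.trans ((smul_le_smul_of_nonneg_left (h3.trans h4) hC0').trans (le_of_eq ?_))
    rw [smul_smul]; congr 1; push_cast; ring
  have hF : star (approx E y r Q) * approx E y r Q ≤ ((2 * C ^ 3 : ℝ) : ℂ) • 1 := by
    have e1 : star (approx E y r Q) * approx E y r Q =
        ∑ j, star (r * Q.e j * y * ψ j) * (r * Q.e j * y * ψ j) := by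
      rw [approx, star_sum, Finset.sum_mul_sum]
      refine Finset.sum_congr rfl fun i _ => Finset.sum_eq_single i (fun j _ hij => ?_) (by simp)
      have h0 : star (r * Q.e i) * (r * Q.e j) = 0 := by
        rw [(hqr i).isSelfAdjoint.star_eq, mul_assoc, ← mul_assoc (Q.e i),
          hcomm _ (Q.mem i) _ hr, mul_assoc, Q.orth i j hij.symm]
        simp
      have e2 : star (r * Q.e i * y * ψ i) * (r * Q.e j * y * ψ j) =
        star (ψ i) * star y * (star (r * Q.e i) * (r * Q.e j)) * y * ψ j := by
        simp only [star_mul, mul_assoc]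
      exact e2.trans (by rw [h0, mul_zero, zero_mul, zero_mul])
    have e2 : ∑ j, phi E y (r * Q.e j) = phi E y r := by
      rw [← phi_sum, ← Finset.mul_sum, Q.sum, mul_one]
    rw [e1]
    refine (Finset.sum_le_sum fun j _ => hx j).trans ?_
    rw [← Finset.smul_sum, e2]
    refine (smul_le_smul_of_nonneg_left (phi_le hT hE hy hrM (proj_le_one hrp))
      (by exact_mod_cast (by positivity : 0 ≤ 2 * C ^ 2))).trans (le_of_eq ?_)
    rw [← hC, smul_smul]; congr 1; push_cast; ring
  have := norm_le_of_le_smul_one (star_mul_self_nonneg _) (by positivity) hF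
  rw [CStarRing.norm_star_mul_self] at this
  rw [← hC]
  have h3 : 0 ≤ C ^ 3 := by positivity
  nlinarith [norm_nonneg (approx E y r Q)]

include hT hE hy hr hrp hcomm in
theorem le_trace_approx (Q : Part A) :
    energy T E y r Q - (T (phi E y r * phi E y r)).re / 2 ≤
      (T (star y * approx E y r Q)).re := by
  have hrM := hE.sub _ hr
  have hqM := fun j => hE.sub _ (Q.mem j)
  have hqr := fun j => Part.isStarProjection_mul hrp (Q.proj j) (hcomm _ hr _ (Q.mem j))
  have hqrM := fun j => mul_mem hrM (hqM j)
  have hφA := fun j => phi_mem hE hy (hqrM j)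
  have hxA := fun j => excess_mem hE hy hrM (hqrM j)
  have hxs := fun j => isSelfAdjoint_excess hT hE hy hrM hrp (hqrM j) (hqr j)
  have e1 : T (star y * approx E y r Q) =
      ∑ j, T (phi E y (r * Q.e j) * pos (excess E y r (r * Q.e j))) := by
    rw [approx, Finset.mul_sum, map_sum]
    refine Finset.sum_congr rfl fun j _ => ?_
    rw [phi, hE.trace_mul (mul_mem (mul_mem (star_mem hy) (hqrM j)) hy) (pos_mem (hxA j))]
    simp only [mul_assoc]
  have e2 : ∑ j, phi E y (r * Q.e j) = phi E y r := by
    rw [← phi_sum, ← Finset.mul_sum, Q.sum, mul_one]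
  have e3 : energy T E y r Q - (T (phi E y r * phi E y r)).re / 2 =
      ∑ j, (T (phi E y (r * Q.e j) * excess E y r (r * Q.e j))).re := by
    have : ∀ j, T (phi E y (r * Q.e j) * excess E y r (r * Q.e j)) =
        T (phi E y (r * Q.e j) * phi E y (r * Q.e j)) -
          (1 / 2 : ℂ) * T (phi E y (r * Q.e j) * phi E y r) := fun j => by
      rw [excess, mul_sub, map_sub, mul_smul_comm, map_smul, smul_eq_mul]
    simp only [this]
    rw [← Complex.re_sum, Finset.sum_sub_distrib, ← Finset.mul_sum, ← map_sum (g := T) (s := Finset.univ) (f := fun j => phi E y (r * Q.e j) * phi E y r), ← Finset.sum_mul, e2]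
    simp [energy]
    ring
  rw [e1, e3, Complex.re_sum]
  refine Finset.sum_le_sum fun j _ => hT.re_mono (hE.sub _ (mul_mem (hφA j) (hxA j)))
    (hE.sub _ (mul_mem (hφA j) (pos_mem (hxA j)))) ?_
  exact mul_le_mul_of_comm hcomm (hxA j) (pos_mem (hxA j)) (hφA j) (le_pos (hxs j))
    (phi_nonneg hT hE hy (hqrM j) (proj_nonneg (hqr j)))

end approx

/-- If `∑ ‖E (y* e_i y)‖₂²` is bounded below over all partitions of `A`, then the closed
`A`-bimodule of `y` contains a non-zero `w` with `p w ∈ w A` for all projections `p ∈ A`. -/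
theorem exists_partial_normalizer [Nontrivial H] (hT : IsTrace M T) (hE : IsExp M A T E)
    (hM : ∀ x ∈ M, (∀ y ∈ M, x * y = y * x) → ∃ c : ℂ, x = c • 1)
    (hcomm : ∀ a ∈ A, ∀ b ∈ A, a * b = b * a) {y : H →L[ℂ] H} (hy : y ∈ M) {c : ℝ} (hc : 0 < c)
    (h : ∀ P : Part A, c ≤ energy T E y 1 P) :
    ∃ w ∈ M, w ≠ 0 ∧
      (∀ p ∈ A, IsStarProjection p → ∃ e ∈ A, IsStarProjection e ∧ p * w = w * e) ∧
      (∀ n ∈ M, (∀ a ∈ A, ∀ b ∈ A, T (n * (a * y * b)) = 0) → T (n * w) = 0) ∧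
      ∀ p e : H →L[ℂ] H, (∀ a ∈ A, ∀ b ∈ A, a * y * b * p = e * (a * y * b)) → w * p = e * w := by
  obtain ⟨r, hr, hrp, c', hc', hQ⟩ := exists_localization hT hE hy hcomm hc h
  have hrM := hE.sub _ hr
  obtain ⟨l, hl⟩ := Part.exists_ultrafilter hcomm
  obtain ⟨w, hw⟩ := exists_wotLim l (approx (A := A) E y r) _
    (norm_approx_le hT hE hy hcomm hr hrp)
  have hFM := fun Q : Part A => approx_mem hE hy hr Q
  have hwM : w ∈ M := hw.mem M hFM
  have hpos : ∀ Q : Part A, ∀ j, pos (excess E y r (r * Q.e j)) ∈ A := fun Q j =>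
    pos_mem (excess_mem hE hy hrM (mul_mem hrM (hE.sub _ (Q.mem j))))
  refine ⟨w, hwM, ?_, ?_, ?_, ?_⟩
  · rintro rfl
    have h1 := hT.tendsto hM (hw.const_mul (star y)) (fun Q => mul_mem (star_mem hy) (hFM Q))
      (mul_mem (star_mem hy) hwM)
    have h2 := (Complex.continuous_re.tendsto _).comp h1
    have h3 := ge_of_tendsto' h2 (b := c') fun Q =>
      le_trans (by linarith [hQ Q]) (le_trace_approx hT hE hy hcomm hr hrp Q)
    simp at h3
    linarith
  · intro p hp hpp
    have hrp' := mul_mem hr hp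
    have hxA := excess_mem hE hy hrM (hE.sub _ hrp')
    have hxs := isSelfAdjoint_excess hT hE hy hrM hrp (hE.sub _ hrp')
      (Part.isStarProjection_mul hrp hpp (hcomm _ hr _ hp))
    have hx' : excess E y r (r * (1 - p)) = -excess E y r (r * p) := by
      rw [mul_sub, mul_one, excess, phi_sub, excess]
      module
    obtain ⟨e, he, hep, he1, he2⟩ := exists_support (pos_mem hxA)
    obtain ⟨e', he', hep', he1', he2'⟩ := exists_support (pos_mem (neg_mem hxA))
    have hee : e * e' = 0 := by
      have h1 := he2 _ (pos_mul_pos_neg hxs)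
      rw [hcomm _ he _ (pos_mem (neg_mem hxA))] at h1
      rw [hcomm _ he _ he']
      exact he2' _ h1
    have key : ∀ p ∈ A, IsStarProjection p → ∀ e ∈ A, IsStarProjection e →
        pos (excess E y r (r * p)) * e = pos (excess E y r (r * p)) → p * w * e = p * w := by
      intro p hp hpp e he hep h
      refine ((hw.const_mul p).mul_const e).unique (l := (l : Filter (Part A))) ?_
      refine (hw.const_mul p).congr' ((hl p hp hpp).mono fun Q hQ => ?_)
      exact (mul_approx_mul hT hE hy hcomm hr hrp hp hpp hQ he hep h).symm
    have k1 := key p hp hpp e he hep (he1 _ fun _ h => h)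
    have k2 := key (1 - p) (sub_mem (one_mem A) hp) hpp.one_sub e' he' hep'
      (hx' ▸ he1' _ fun _ h => h)
    refine ⟨e, he, hep, ?_⟩
    have k3 : (1 - p) * w * e = 0 := by
      rw [← k2, mul_assoc _ e', ← hcomm _ he _ he', hee, mul_zero]
    calc p * w = p * w * e + (1 - p) * w * e := by rw [k1, k3, add_zero]
      _ = w * e := by noncomm_ring
  · intro n hn hny
    refine tendsto_nhds_unique (hT.tendsto hM (hw.const_mul n) (fun Q => mul_mem hn (hFM Q))
      (mul_mem hn hwM)) (tendsto_const_nhds.congr fun Q => ?_)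
    rw [approx, Finset.mul_sum, map_sum]
    exact (Finset.sum_eq_zero fun j _ => hny _ (mul_mem hr (Q.mem j)) _ (hpos Q j)).symm
  · intro p e hpe
    refine (hw.mul_const p).unique (l := (l : Filter (Part A))) ((hw.const_mul e).congr' (.of_forall fun Q => ?_))
    simp only [approx, Finset.mul_sum, Finset.sum_mul]
    exact Finset.sum_congr rfl fun j _ => (hpe _ (mul_mem hr (Q.mem j)) _ (hpos Q j)).symm

section normalizer

variable {N : VonNeumannAlgebra H}

theorem support_commute {s b e : H →L[ℂ] H} (hs : star s = s) (hsb : s * b = b * s)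
    (hep : IsStarProjection e) (he1 : b * e = b) (he2 : ∀ t : H →L[ℂ] H, b * t = 0 → e * t = 0) :
    s * e = e * s := by
  have h1 : e * (s * (1 - e)) = 0 := he2 _ <| by
    rw [← mul_assoc, ← hsb, mul_assoc, mul_sub, mul_one, he1, sub_self, mul_zero]
  rw [mul_sub, mul_one, mul_sub, sub_eq_zero] at h1
  have h3 := congr(star $h1)
  simp only [star_mul, hs, hep.isSelfAdjoint.star_eq] at h3
  rw [h3, mul_assoc, ← h1]

/-- A self-adjoint `s` with `s A s ⊆ A` which is orthogonal to the normalizing algebra vanishes. -/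
theorem eq_zero_of_selfAdjoint [Nontrivial H] (hT : IsTrace M T) (hAM : ∀ a ∈ A, a ∈ M)
    (hcomm : ∀ a ∈ A, ∀ b ∈ A, a * b = b * a) (hAN : ∀ a ∈ A, a ∈ N)
    (hN : ∀ u ∈ M, star u = u → u * u = 1 → (∀ a ∈ A, u * a * u ∈ A) → u ∈ N)
    {s : H →L[ℂ] H} (hs : s ∈ M) (hss : star s = s) (hsA : ∀ a ∈ A, s * a * s ∈ A)
    (horth : ∀ n ∈ N, T (n * s) = 0) : s = 0 := by
  obtain ⟨h, hh⟩ : ∃ h, h = s * s := ⟨_, rfl⟩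
  have hhA : h ∈ A := by simpa [hh] using hsA 1 (one_mem A)
  have hhs : IsSelfAdjoint h := by rw [IsSelfAdjoint, hh, star_mul, hss]
  have hh0 : 0 ≤ h := by
    have := star_mul_self_nonneg s
    rwa [hss, ← hh] at this
  have hsh : Commute h s := by rw [hh]; exact (Commute.refl s).mul_left (Commute.refl s)
  suffices H : ∀ ε : ℝ, 0 < ε → ‖h‖ ≤ 0 + ε by
    have h0 : h = 0 := norm_le_zero_iff.1 (le_of_forall_pos_le_add H)
    rw [← CStarRing.star_mul_self_eq_zero_iff, hss, ← hh, h0]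
  intro ε hε
  obtain ⟨b, hb⟩ : ∃ b, b = cfc (fun t : ℝ => max (t - ε) 0) h := ⟨_, rfl⟩
  obtain ⟨g, hg⟩ : ∃ g, g = cfc (fun t : ℝ => (Real.sqrt (max t ε))⁻¹) h := ⟨_, rfl⟩
  have hcont : Continuous fun t : ℝ => (Real.sqrt (max t ε))⁻¹ := by
    refine Continuous.inv₀ (by fun_prop) fun t => (Real.sqrt_pos.2 ?_).ne'
    exact lt_max_of_lt_right hε
  have hbA : b ∈ A := hb ▸ cfc_mem hhA _
  have hgA : g ∈ A := hg ▸ cfc_mem hhA _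
  have hb0 : 0 ≤ b := hb ▸ cfc_nonneg fun _ _ => le_max_right _ _
  have hbs : star b = b := (IsSelfAdjoint.of_nonneg hb0).star_eq
  have hgs : star g = g := by
    rw [hg]; exact IsSelfAdjoint.star_eq (cfc_predicate _ _)
  have hsb : s * b = b * s := by rw [hb]; exact (hsh.cfc_real _).symm
  have hsg : s * g = g * s := by rw [hg]; exact (hsh.cfc_real _).symm
  obtain ⟨e, he, hep, he1, he2⟩ := exists_support hbA
  have hbe : b * e = b := he1 _ fun _ h => h
  have hse := support_commute hss hsb hep hbe he2
  have hee : e * e = e := hep.isIdempotentElem.eq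
  have hes : star e = e := hep.isSelfAdjoint.star_eq
  have hge : g * e = e * g := hcomm _ hgA _ he
  have hhe : h * e = e * h := hcomm _ hhA _ he
  have hgh : g * h = h * g := hcomm _ hgA _ hhA
  have hbg : b * (g * g * h - 1) = 0 := by
    have c1 : g * g * h = cfc (fun t : ℝ => (Real.sqrt (max t ε))⁻¹ * (Real.sqrt (max t ε))⁻¹ * t) h := by
      rw [cfc_mul (fun t : ℝ => (Real.sqrt (max t ε))⁻¹ * (Real.sqrt (max t ε))⁻¹) (fun t => t) h
        (hcont.mul hcont).continuousOn, cfc_mul _ _ h hcont.continuousOn hcont.continuousOn,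
        cfc_id' ℝ h, hg]
    have c2 : b * (g * g * h) = b := by
      rw [c1, hb, ← cfc_mul (fun t : ℝ => max (t - ε) 0)
        (fun t => (Real.sqrt (max t ε))⁻¹ * (Real.sqrt (max t ε))⁻¹ * t) h (by fun_prop)
        ((hcont.mul hcont).mul continuous_id').continuousOn]
      refine cfc_congr fun t _ => ?_
      rcases le_total t ε with ht | ht
      · simp [ht]
      · have ht0 : 0 < t := hε.trans_le ht
        have := Real.mul_self_sqrt ht0.le
        have h0 : Real.sqrt t ≠ 0 := (Real.sqrt_pos.2 ht0).ne'
        have : (Real.sqrt t)⁻¹ * (Real.sqrt t)⁻¹ * t = 1 := by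
          nth_rewrite 3 [← this]; field_simp
        simp [ht, this]
    rw [mul_sub, c2, mul_one, sub_self]
  have hg1 : e * (g * g * h) = e := by
    have := he2 _ hbg
    rwa [mul_sub, mul_one, sub_eq_zero] at this
  obtain ⟨k, hk⟩ : ∃ k, k = e * g := ⟨_, rfl⟩
  have hkA : k ∈ A := hk ▸ mul_mem he hgA
  have hks : star k = k := by rw [hk, star_mul, hes, hgs, hge]
  have hsk : s * k = k * s := by rw [hk, ← mul_assoc, hse, mul_assoc, hsg, mul_assoc]
  have hke : k * e = k := by rw [hk, mul_assoc, hge, ← mul_assoc, hee]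
  have hke' : k * (1 - e) = 0 := by rw [mul_sub, mul_one, hke, sub_self]
  have hek' : (1 - e) * k = 0 := by rw [sub_mul, one_mul, hcomm _ he _ hkA, hke, sub_self]
  have hskk : s * k * (s * k) = e := by
    have : s * k * (s * k) = e * g * (e * g) * (s * s) := by
      rw [hsk, ← hk]
      calc k * s * (k * s) = k * (s * k) * s := by noncomm_ring
        _ = _ := by rw [hsk]; noncomm_ring
    rw [this, ← hh]
    calc e * g * (e * g) * h = e * (g * e) * g * h := by noncomm_ring
      _ = (e * e) * (g * g * h) := by rw [hge]; noncomm_ring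
      _ = e := by rw [hee, hg1]
  have he1A : 1 - e ∈ A := sub_mem (one_mem A) he
  have hu : s * k + (1 - e) ∈ N := by
    refine hN _ (add_mem (mul_mem hs (hAM _ hkA)) (hAM _ he1A)) ?_ ?_ ?_
    · simp [hss, hks, hes, hsk]
    · have x1 : s * k * (1 - e) = 0 := by rw [mul_assoc, hke', mul_zero]
      have x2 : (1 - e) * (s * k) = 0 := by rw [hsk, ← mul_assoc, hek', zero_mul]
      rw [add_mul, mul_add, mul_add, hskk, x1, x2, hep.one_sub.isIdempotentElem.eq]
      abel
    · intro a ha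
      have x1 : s * k * a * (1 - e) = 0 := by
        rw [mul_assoc, hcomm _ ha _ he1A, mul_assoc, ← mul_assoc k, hke', zero_mul, mul_zero]
      have x2 : (1 - e) * a * (s * k) = 0 := by
        rw [hcomm _ he1A _ ha, mul_assoc, hsk, ← mul_assoc (1 - e), hek', zero_mul, mul_zero]
      have x3 : s * k * a * (s * k) = s * (k * a * k) * s := by
        nth_rewrite 2 [hsk]; noncomm_ring
      rw [add_mul, add_mul, mul_add, mul_add, x1, x2, x3, add_zero, zero_add]
      exact add_mem (hsA _ (mul_mem (mul_mem hkA ha) hkA)) (mul_mem (mul_mem he1A ha) he1A)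
  have hskN : s * k ∈ N := by
    have := sub_mem hu (hAN _ he1A)
    rwa [add_sub_cancel_right] at this
  have hT0 := horth _ (mul_mem hskN (hAN _ (mul_mem hgA hhA)))
  have hse0 : s * e = 0 := by
    refine hT.faithful _ (mul_mem hs (hAM _ he)) ?_
    rw [← hT0]
    congr 1
    have y1 : s * k * (g * h) * s = e * (g * g * h) * h := by
      have hsh' : h * s = s * h := hsh
      rw [hsk, hk]
      calc e * g * s * (g * h) * s = e * g * (s * g) * h * s := by noncomm_ring
        _ = e * g * g * (s * (h * s)) := by rw [hsg]; noncomm_ring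
        _ = e * g * g * h * (s * s) := by rw [hsh', ← mul_assoc s, ← hh]; noncomm_ring
        _ = _ := by rw [← hh]; noncomm_ring
    rw [y1, hg1, star_mul, hss, hes]
    calc e * s * (s * e) = e * (h * e) := by rw [hh]; noncomm_ring
      _ = e * h := by rw [hhe, ← mul_assoc, hee]
  have hhb : h * b = 0 := by
    rw [← hbe, hcomm _ hbA _ he, ← mul_assoc, hh, mul_assoc s, hse0, mul_zero, zero_mul]
  have hbb : b * b = -((ε : ℂ) • b) := by
    have : b * b = b * h - (ε : ℂ) • b := by
      have c1 : b * h - (ε : ℂ) • b = cfc (fun t : ℝ => max (t - ε) 0 * t - ε • max (t - ε) 0) h := by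
        rw [cfc_sub _ _ h, cfc_mul _ _ h, cfc_smul ε _ h, cfc_id' ℝ h, hb, Complex.coe_smul]
      rw [c1, hb, ← cfc_mul _ _ h]
      refine cfc_congr fun t _ => ?_
      rcases le_total t ε with ht | ht
      · simp [ht]
      · simp [ht]; ring
    rw [this, hcomm _ hbA _ hhA, hhb, zero_sub]
  have hb2 : b = 0 := by
    have h1 : 0 ≤ b * b := by simpa [hbs] using star_mul_self_nonneg b
    have h2 : b * b ≤ 0 := by
      rw [hbb, neg_nonpos]
      exact smul_nonneg (by exact_mod_cast hε.le) hb0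
    have := le_antisymm h2 h1
    rwa [← CStarRing.star_mul_self_eq_zero_iff, hbs]
  rw [zero_add]
  refine norm_le_of_le_smul_one hh0 hε.le ?_
  have h3 : h - (ε : ℂ) • 1 ≤ b := by
    have c1 : h - (ε : ℂ) • 1 = cfc (fun t : ℝ => t - ε) h := by
      rw [cfc_sub _ _ h, cfc_id' ℝ h, cfc_const ε h, Algebra.algebraMap_eq_smul_one,
        Complex.coe_smul]
    rw [c1, hb]
    exact cfc_mono fun t _ => le_max_left _ _
  rwa [hb2, sub_nonpos] at h3

theorem conj_mem_of_forall_projection [Nontrivial H] 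
    (hcomm : ∀ a ∈ A, ∀ b ∈ A, a * b = b * a) (hmasa : ∀ x ∈ M, (∀ a ∈ A, x * a = a * x) → x ∈ A)
    (hAM : ∀ a ∈ A, a ∈ M) {v : H →L[ℂ] H} (hv : v ∈ M)
    (h : ∀ p ∈ A, IsStarProjection p → ∃ e ∈ A, IsStarProjection e ∧ p * v = v * e)
    {a : H →L[ℂ] H} (ha : a ∈ A) : v * a * star v ∈ A := by
  refine hmasa _ (mul_mem (mul_mem hv (hAM _ ha)) (star_mem hv)) fun b hb =>
    commute_of_commute_projections (fun p hp hpp => ?_) hb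
  obtain ⟨e, he, hep, hpv⟩ := h p hp hpp
  have h2 := congr(star $hpv)
  rw [star_mul, star_mul, hpp.isSelfAdjoint.star_eq, hep.isSelfAdjoint.star_eq] at h2
  calc v * a * star v * p = v * (a * e) * star v := by rw [mul_assoc, h2]; noncomm_ring
    _ = v * e * a * star v := by rw [hcomm _ ha _ he]; noncomm_ring
    _ = p * (v * a * star v) := by rw [← hpv]; noncomm_ring

theorem corner_eq_zero [Nontrivial H] (hT : IsTrace M T) (hAM : ∀ a ∈ A, a ∈ M)
    (hcomm : ∀ a ∈ A, ∀ b ∈ A, a * b = b * a) (hAN : ∀ a ∈ A, a ∈ N) (hNM : ∀ a ∈ N, a ∈ M)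
    (hN : ∀ u ∈ M, star u = u → u * u = 1 → (∀ a ∈ A, u * a * u ∈ A) → u ∈ N)
    {v p q : H →L[ℂ] H} (hv : v ∈ M) (h1 : ∀ a ∈ A, v * a * star v ∈ A)
    (h2 : ∀ a ∈ A, star v * a * v ∈ A) (horth : ∀ n ∈ N, T (n * v) = 0)
    (hp : p ∈ A) (hpp : IsStarProjection p) (hq : q ∈ A) (hqp : IsStarProjection q)
    (hpq : p * q = 0) : p * v * q = 0 := by
  have hqp0 : q * p = 0 := by rw [hcomm _ hq _ hp, hpq]
  have hps := hpp.isSelfAdjoint.star_eq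
  have hqs := hqp.isSelfAdjoint.star_eq
  have hpM := hAM _ hp
  have hqM := hAM _ hq
  obtain ⟨x, hx⟩ : ∃ x, x = p * v * q := ⟨_, rfl⟩
  have hxs : star x = q * star v * p := by simp [hx, hps, hqs, mul_assoc]
  have hxM : x ∈ M := hx ▸ mul_mem (mul_mem hpM hv) hqM
  have hxT : ∀ n ∈ N, T (n * x) = 0 := fun n hn => by
    have e : n * x = (n * p * v) * q := by rw [hx]; noncomm_ring
    rw [e, hT.comm _ (mul_mem (mul_mem (hNM _ hn) hpM) hv) _ hqM, ← mul_assoc, ← mul_assoc]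
    exact horth _ (mul_mem (mul_mem (hAN _ hq) hn) (hAN _ hp))
  have hs : x + star x = 0 := by
    refine eq_zero_of_selfAdjoint hT hAM hcomm hAN hN (add_mem hxM (star_mem hxM))
      (by rw [star_add, star_star, add_comm]) (fun a ha => ?_) fun n hn => ?_
    · have y1 : x * a * x = 0 := by
        calc x * a * x = p * v * (q * a) * p * v * q := by rw [hx]; noncomm_ring
          _ = p * v * a * (q * p) * v * q := by rw [hcomm _ hq _ ha]; noncomm_ring
          _ = 0 := by rw [hqp0]; simp
      have y2 : star x * a * star x = 0 := by
        calc star x * a * star x = q * star v * (p * a) * q * star v * p := by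
              rw [hxs]; noncomm_ring
          _ = q * star v * a * (p * q) * star v * p := by rw [hcomm _ hp _ ha]; noncomm_ring
          _ = 0 := by rw [hpq]; simp
      have y3 : x * a * star x = p * (v * (q * a * q) * star v) * p := by
        rw [hxs, hx]; noncomm_ring
      have y4 : star x * a * x = q * (star v * (p * a * p) * v) * q := by
        rw [hxs, hx]; noncomm_ring
      have y5 : (x + star x) * a * (x + star x) = x * a * star x + star x * a * x := by
        have : (x + star x) * a * (x + star x) =
          x * a * x + x * a * star x + star x * a * x + star x * a * star x := by noncomm_ring
        rw [this, y1, y2, zero_add, add_zero]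
      rw [y5, y3, y4]
      exact add_mem (mul_mem (mul_mem hp (h1 _ (mul_mem (mul_mem hq ha) hq))) hp)
        (mul_mem (mul_mem hq (h2 _ (mul_mem (mul_mem hp ha) hp))) hq)
    · have e : star (star n * x) = star x * n := by simp
      have := hT.star_apply (mul_mem (star_mem (hNM _ hn)) hxM)
      rw [e, hxT _ (star_mem hn), star_zero, hT.comm _ (star_mem hxM) _ (hNM _ hn)] at this
      rw [mul_add, map_add, hxT n hn, this, add_zero]
  have h3 : p * x = x := by rw [hx, ← mul_assoc, ← mul_assoc, hpp.isIdempotentElem.eq]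
  have h4 : p * star x = 0 := by rw [hxs, ← mul_assoc, ← mul_assoc, hpq]; simp
  have h5 : p * (x + star x) = x := by rw [mul_add, h3, h4, add_zero]
  rw [← hx, ← h5, hs, mul_zero]

end normalizer

section small

variable {N : VonNeumannAlgebra H}

/-- An operator orthogonal to the normalizing algebra has small energy along partitions. -/
theorem exists_energy_lt [Nontrivial H] (hT : IsTrace M T) (hE : IsExp M A T E)
    (hM : ∀ x ∈ M, (∀ y ∈ M, x * y = y * x) → ∃ c : ℂ, x = c • 1)
    (hcomm : ∀ a ∈ A, ∀ b ∈ A, a * b = b * a) (hmasa : ∀ x ∈ M, (∀ a ∈ A, x * a = a * x) → x ∈ A)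
    (hAN : ∀ a ∈ A, a ∈ N) (hNM : ∀ a ∈ N, a ∈ M)
    (hN : ∀ u ∈ M, star u = u → u * u = 1 → (∀ a ∈ A, u * a * u ∈ A) → u ∈ N)
    {y : H →L[ℂ] H} (hy : y ∈ M) (horth : ∀ n ∈ N, T (n * y) = 0) {ε : ℝ} (hε : 0 < ε) :
    ∃ P : Part A, energy T E y 1 P < ε := by
  have hAM := hE.sub
  by_contra! hcon
  obtain ⟨w, hw, hw0, hwp, hwo, -⟩ := exists_partial_normalizer hT hE hM hcomm hy hε hcon
  have hwN : ∀ n ∈ N, T (n * w) = 0 := fun n hn => hwo n (hNM n hn) fun a ha b hb => by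
    have e : n * (a * y * b) = n * a * y * b := by noncomm_ring
    rw [e, hT.comm _ (mul_mem (mul_mem (hNM _ hn) (hAM _ ha)) hy) _ (hAM _ hb), ← mul_assoc,
      ← mul_assoc]
    exact horth _ (mul_mem (mul_mem (hAN _ hb) hn) (hAN _ ha))
  have hwA : ∀ a ∈ A, w * a * star w ∈ A := fun a ha =>
    conj_mem_of_forall_projection hcomm hmasa hAM hw hwp ha
  have hsw := star_mem hw
  obtain ⟨z, hz⟩ : ∃ z, z = star w * w := ⟨_, rfl⟩
  have hzM : z ∈ M := hz ▸ mul_mem hsw hw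
  have hTz0 : 0 < (T z).re := by
    have h1 := Complex.nonneg_iff.1 (hz ▸ hT.nonneg_star w hw)
    refine lt_of_le_of_ne h1.1 fun h => hw0 (hT.faithful w hw ?_)
    rw [← hz]
    exact Complex.ext h.symm h1.2.symm
  have hlow : ∀ Q : Part A, (T z).re ^ 2 ≤ energy T E (star w) 1 Q := fun Q => by
    have hqM := fun i => hAM _ (Q.mem i)
    have hqs := fun i => (Q.proj i).isSelfAdjoint.star_eq
    have hqq := fun i => (Q.proj i).isIdempotentElem.eq
    have hzs : star z = z := by rw [hz]; simp
    obtain ⟨D, hD⟩ : ∃ D, D = ∑ i, Q.e i * z * Q.e i := ⟨_, rfl⟩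
    have hDM : D ∈ M := hD ▸ sum_mem fun i _ => mul_mem (mul_mem (hqM i) hzM) (hqM i)
    have hDs : star D = D := by simp [hD, star_sum, hqs, hzs, mul_assoc]
    have hTD : T D = T z := by
      have : ∀ i, T (Q.e i * z * Q.e i) = T (Q.e i * z) := fun i => by
        rw [hT.comm _ (mul_mem (hqM i) hzM) _ (hqM i), ← mul_assoc, hqq]
      rw [hD, map_sum]
      simp only [this]
      rw [← map_sum, ← Finset.sum_mul, Q.sum, one_mul]
    have hDD : T (D * D) = ∑ i, T (phi E (star w) (1 * Q.e i) * phi E (star w) (1 * Q.e i)) := by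
      rw [hD, Finset.sum_mul_sum, map_sum]
      refine Finset.sum_congr rfl fun i _ => ?_
      rw [Finset.sum_eq_single i (fun j _ hij => ?_) (by simp)]
      · rw [phi, one_mul, star_star, hE.apply_mem hT (hwA _ (Q.mem i))]
        have e1 : Q.e i * z * Q.e i * (Q.e i * z * Q.e i) =
            Q.e i * z * (Q.e i * Q.e i) * star w * (w * Q.e i) := by rw [hz]; noncomm_ring
        have e2 : w * Q.e i * star w * (w * Q.e i * star w) =
            (w * Q.e i) * (Q.e i * z * Q.e i * star w) := by
          have : (w * Q.e i) * (Q.e i * z * Q.e i * star w) =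
            w * (Q.e i * Q.e i) * z * Q.e i * star w := by noncomm_ring
          rw [this, hqq, hz]
          noncomm_ring
        rw [e1, e2, hqq, hT.comm _ (mul_mem hw (hqM i))]
        exact mul_mem (mul_mem (mul_mem (hqM i) hzM) (hqM i)) hsw
      · have : Q.e i * z * Q.e i * (Q.e j * z * Q.e j) =
            Q.e i * z * (Q.e i * Q.e j) * z * Q.e j := by noncomm_ring
        rw [this, Q.orth i j hij.symm]; simp
    have hcs := hT.cauchySchwarz (one_mem M) hDM
    rw [star_one, one_mul, one_mul, hT.one, hDs, hTD, hDD, Complex.one_re, one_mul,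
      Complex.re_sum] at hcs
    refine le_trans ?_ hcs
    rw [← sq_abs]
    gcongr
    exact Complex.abs_re_le_norm _
  obtain ⟨v, hv, hv0, hvp, hvo, hvp'⟩ :=
    exists_partial_normalizer hT hE hM hcomm hsw (sq_pos_of_pos hTz0) hlow
  have hvN : ∀ n ∈ N, T (n * v) = 0 := fun n hn => hvo n (hNM n hn) fun a ha b hb => by
    have e : n * (a * star w * b) = n * a * star w * b := by noncomm_ring
    have hm : b * n * a ∈ N := mul_mem (mul_mem (hAN _ hb) hn) (hAN _ ha)
    have e2 : star (star (b * n * a) * w) = star w * (b * n * a) := by simp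
    have := hT.star_apply (mul_mem (hNM _ (star_mem hm)) hw)
    rw [hwN _ (star_mem hm), star_zero, e2, hT.comm _ hsw _ (hNM _ hm)] at this
    rw [e, hT.comm _ (mul_mem (mul_mem (hNM _ hn) (hAM _ ha)) hsw) _ (hAM _ hb), ← mul_assoc,
      ← mul_assoc, this]
  have hvA : ∀ a ∈ A, v * a * star v ∈ A := fun a ha =>
    conj_mem_of_forall_projection hcomm hmasa hAM hv hvp ha
  have hvA' : ∀ a ∈ A, star v * a * v ∈ A := fun a ha => by
    have := conj_mem_of_forall_projection (v := star v) hcomm hmasa hAM (star_mem hv) ?_ ha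
    · rwa [star_star] at this
    · intro p hp hpp
      obtain ⟨e, he, hep, hpe⟩ := hwp p hp hpp
      have hpe' := congr(star $hpe)
      rw [star_mul, star_mul, hpp.isSelfAdjoint.star_eq, hep.isSelfAdjoint.star_eq] at hpe'
      refine ⟨e, he, hep, ?_⟩
      have := hvp' p e fun a ha b hb => by
        calc a * star w * b * p = a * (star w * p) * b := by
              rw [mul_assoc, hcomm _ hb _ hp]; noncomm_ring
          _ = a * e * star w * b := by rw [hpe']; noncomm_ring
          _ = e * (a * star w * b) := by rw [hcomm _ ha _ he]; noncomm_ring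
      have := congr(star $this)
      rwa [star_mul, star_mul, hpp.isSelfAdjoint.star_eq, hep.isSelfAdjoint.star_eq] at this
  have hvmem : v ∈ A := by
    refine hmasa v hv fun a ha => commute_of_commute_projections (fun p hp hpp => ?_) ha
    have hp' := sub_mem (one_mem A) hp
    have hz1 : p * (1 - p) = 0 := by rw [mul_sub, mul_one, hpp.isIdempotentElem.eq, sub_self]
    have hz2 : (1 - p) * p = 0 := by rw [sub_mul, one_mul, hpp.isIdempotentElem.eq, sub_self]
    have h1 := corner_eq_zero hT hAM hcomm hAN hNM hN hv hvA hvA' hvN hp hpp hp' hpp.one_sub hz1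
    have h2 := corner_eq_zero hT hAM hcomm hAN hNM hN hv hvA hvA' hvN hp' hpp.one_sub hp hpp hz2
    rw [mul_sub, mul_one, sub_eq_zero] at h1
    rw [sub_mul, one_mul, sub_mul, sub_eq_zero] at h2
    rw [h1, h2]
  exact hv0 (hT.faithful v hv (hvN _ (star_mem (hAN _ hvmem))))

end small

theorem exists_signs {ι : Type*} (x : ι → H →L[ℂ] H) (S : Finset ι) :
    ∃ s : ι → ℂ, (∀ i, s i = 1 ∨ s i = -1) ∧
      (T (star (∑ i ∈ S, s i • x i) * ∑ i ∈ S, s i • x i)).re ≤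
        ∑ i ∈ S, (T (star (x i) * x i)).re := by
  classical
  induction S using Finset.induction_on with
  | empty => exact ⟨fun _ => 1, fun _ => Or.inl rfl, by simp⟩
  | insert j S hj ih =>
    obtain ⟨s, hs, h⟩ := ih
    obtain ⟨X, hX⟩ : ∃ X, X = ∑ i ∈ S, s i • x i := ⟨_, rfl⟩
    rw [← hX] at h
    have hsum : ∀ c : ℂ, ∑ i ∈ insert j S, Function.update s j c i • x i = c • x j + X := fun c => by
      rw [Finset.sum_insert hj, Function.update_self, hX]
      congr 1
      refine Finset.sum_congr rfl fun i hi => ?_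
      rw [Function.update_of_ne (ne_of_mem_of_not_mem hi hj)]
    have hpar : (T (star (x j + X) * (x j + X))).re + (T (star (-x j + X) * (-x j + X))).re =
        2 * (T (star (x j) * x j)).re + 2 * (T (star X * X)).re := by
      have e : star (x j + X) * (x j + X) + star (-x j + X) * (-x j + X) =
          (2 : ℂ) • (star (x j) * x j) + (2 : ℂ) • (star X * X) := by
        simp only [star_add, star_neg, two_smul]
        noncomm_ring
      rw [← Complex.add_re, ← map_add, e]
      simp
    have hupd : ∀ c : ℂ, (c = 1 ∨ c = -1) → ∀ i, Function.update s j c i = 1 ∨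
        Function.update s j c i = -1 := fun c hc i => by
      by_cases hij : i = j
      · subst hij; simpa using hc
      · simpa [hij] using hs i
    rcases le_total (T (star (x j + X) * (x j + X))).re (T (star (-x j + X) * (-x j + X))).re
      with hle | hle
    · refine ⟨Function.update s j 1, hupd 1 (Or.inl rfl), ?_⟩
      rw [hsum, Finset.sum_insert hj, one_smul]
      linarith
    · refine ⟨Function.update s j (-1), hupd _ (Or.inr rfl), ?_⟩
      rw [hsum, Finset.sum_insert hj, neg_smul, one_smul]
      linarith

section final

variable {N : VonNeumannAlgebra H} {F : (H →L[ℂ] H) →ₗ[ℂ] (H →L[ℂ] H)}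

/-- There are symmetries `v ∈ A` for which `E (u* v u)` is almost as small in 2-norm as `F u`. -/
theorem exists_symmetry [Nontrivial H] (hT : IsTrace M T) (hE : IsExp M A T E)
    (hF : IsExp M N T F)
    (hM : ∀ x ∈ M, (∀ y ∈ M, x * y = y * x) → ∃ c : ℂ, x = c • 1)
    (hcomm : ∀ a ∈ A, ∀ b ∈ A, a * b = b * a) (hmasa : ∀ x ∈ M, (∀ a ∈ A, x * a = a * x) → x ∈ A)
    (hAN : ∀ a ∈ A, a ∈ N)
    (hN : ∀ u ∈ M, star u = u → u * u = 1 → (∀ a ∈ A, u * a * u ∈ A) → u ∈ N)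
    {u : H →L[ℂ] H} (hu : u ∈ M) (hu1 : star u * u = 1) {ε : ℝ} (hε : 0 < ε) :
    ∃ v ∈ A, star v = v ∧ v * v = 1 ∧
      (T (star (phi E u v) * phi E u v)).re ≤ (T (star (F u) * F u)).re + ε := by
  have hAM := hE.sub
  obtain ⟨a, ha⟩ : ∃ a, a = F u := ⟨_, rfl⟩
  have haN : a ∈ N := ha ▸ hF.mem u hu
  have haM := hF.sub _ haN
  obtain ⟨y, hy⟩ : ∃ y, y = u - a := ⟨_, rfl⟩
  have hyM : y ∈ M := hy ▸ sub_mem hu haM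
  have hyN : ∀ n ∈ N, T (n * y) = 0 := fun n hn => by
    rw [hT.comm _ (hF.sub _ hn) _ hyM, hy, ha]
    exact hF.orth u hu n hn
  have hyN' : ∀ n ∈ N, T (star y * n) = 0 := fun n hn => by
    have h1 : star (star n * y) = star y * n := by simp
    rw [← h1, hT.star_apply (mul_mem (star_mem (hF.sub _ hn)) hyM), hyN _ (star_mem hn), star_zero]
  have hphi : ∀ p ∈ A, phi E u p = phi E a p + phi E y p := fun p hp => by
    have hpM := hAM _ hp
    have h1 : E (star a * p * y) = 0 :=
      hE.eq_of_orth hT (mul_mem (mul_mem (star_mem haM) hpM) hyM) (zero_mem A) fun b hb => by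
        rw [sub_zero, hT.comm _ (mul_mem (mul_mem (star_mem haM) hpM) hyM) _ (hAM _ hb),
          ← mul_assoc]
        exact hyN _ (mul_mem (hAN _ hb) (mul_mem (star_mem haN) (hAN _ hp)))
    have h2 : E (star y * p * a) = 0 :=
      hE.eq_of_orth hT (mul_mem (mul_mem (star_mem hyM) hpM) haM) (zero_mem A) fun b hb => by
        rw [sub_zero, mul_assoc, mul_assoc]
        exact hyN' _ (mul_mem (hAN _ hp) (mul_mem haN (hAN _ hb)))
    have h3 : u = a + y := by rw [hy]; abel
    have h4 : star u * p * u = star a * p * a + star y * p * y + star a * p * y +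
        star y * p * a := by rw [h3, star_add]; noncomm_ring
    rw [phi, h4, map_add, map_add, map_add, h1, h2, add_zero, add_zero, phi, phi]
  have hphi1 : phi E u 1 = 1 := by rw [phi, mul_one, hu1, hE.apply_mem hT (one_mem A)]
  obtain ⟨P, hP⟩ := exists_energy_lt hT hE hM hcomm hmasa hAN hF.sub hN hyM hyN (pow_pos hε 2)
  have heM := fun i => hAM _ (P.mem i)
  have he0 := fun i => proj_nonneg (P.proj i)
  have hs : ∀ {x : H →L[ℂ] H}, x ∈ M → ∀ i, star (phi E x (P.e i)) = phi E x (P.e i) :=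
    fun hx i => (isSelfAdjoint_phi hT hE hx (heM i) (P.proj i)).star_eq
  have hterm : ∀ i, (T (phi E u (P.e i) * phi E u (P.e i))).re ≤ (T (phi E a (P.e i))).re +
      ((T (phi E y (P.e i) * phi E y (P.e i))).re / (2 * ε) +
        ε / 2 * (T (phi E u (P.e i))).re) := fun i => by
    obtain ⟨f, hf⟩ : ∃ f, f = phi E u (P.e i) := ⟨_, rfl⟩
    obtain ⟨b, hb⟩ : ∃ b, b = phi E a (P.e i) := ⟨_, rfl⟩
    obtain ⟨c, hc⟩ : ∃ c, c = phi E y (P.e i) := ⟨_, rfl⟩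
    rw [← hf, ← hb, ← hc]
    have hfA : f ∈ A := hf ▸ phi_mem hE hu (heM i)
    have hbA : b ∈ A := hb ▸ phi_mem hE haM (heM i)
    have hcA : c ∈ A := hc ▸ phi_mem hE hyM (heM i)
    have hf0 : 0 ≤ f := hf ▸ phi_nonneg hT hE hu (heM i) (he0 i)
    have hb0 : 0 ≤ b := hb ▸ phi_nonneg hT hE haM (heM i) (he0 i)
    have hfs : star f = f := hf ▸ hs hu i
    have hcs : star c = c := hc ▸ hs hyM i
    have hf1 : f ≤ 1 := by
      rw [hf, ← hphi1]
      exact phi_mono hT hE hu (heM i) (one_mem M) (proj_le_one (P.proj i))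
    have hfbc : f = b + c := by rw [hf, hb, hc, hphi _ (P.mem i)]
    have h1 : (T (b * f)).re ≤ (T b).re :=
      hT.re_mono (hAM _ (mul_mem hbA hfA)) (hAM _ hbA)
        (by simpa using mul_le_mul_of_comm hcomm hfA (one_mem A) hbA hf1 hb0)
    have h2 : (T (f * f)).re ≤ (T f).re :=
      hT.re_mono (hAM _ (mul_mem hfA hfA)) (hAM _ hfA)
        (by simpa using mul_le_mul_of_comm hcomm hfA (one_mem A) hfA hf1 hf0)
    have h3 : 2 * ε * (T (c * f)).re ≤ (T (c * c)).re + ε ^ 2 * (T (f * f)).re := by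
      have h := (Complex.nonneg_iff.1 (hT.nonneg_star (c - (ε : ℂ) • f)
        (sub_mem (hAM _ hcA) (smul_mem_vN _ (hAM _ hfA))))).1
      have e : star (c - (ε : ℂ) • f) * (c - (ε : ℂ) • f) =
          c * c - ((2 * ε : ℝ) : ℂ) • (c * f) + ((ε ^ 2 : ℝ) : ℂ) • (f * f) := by
        have hfc : f * c = c * f := hcomm _ hfA _ hcA
        simp only [star_sub, star_smul, hcs, hfs, RCLike.star_def, Complex.conj_ofReal, sub_mul,
          mul_sub, smul_mul_assoc, mul_smul_comm, hfc]
        push_cast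
        module
      rw [e, map_add, map_sub, map_smul, map_smul, Complex.add_re, Complex.sub_re, smul_eq_mul,
        smul_eq_mul, Complex.re_ofReal_mul, Complex.re_ofReal_mul] at h
      linarith
    have h4 : (T (f * f)).re = (T (b * f)).re + (T (c * f)).re := by
      rw [← Complex.add_re, ← map_add, ← add_mul, ← hfbc]
    have h5 : (T (c * f)).re ≤ (T (c * c)).re / (2 * ε) + ε / 2 * (T f).re := by
      have : (T (c * c)).re / (2 * ε) + ε / 2 * (T f).re =
          ((T (c * c)).re + ε ^ 2 * (T f).re) / (2 * ε) := by field_simp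
      rw [this, le_div_iff₀ (by positivity)]
      nlinarith [mul_le_mul_of_nonneg_left h2 (sq_nonneg ε)]
    linarith
  obtain ⟨s, hs1, hle⟩ := exists_signs (T := T) (fun i => phi E u (P.e i)) Finset.univ
  refine ⟨∑ i, s i • P.e i, sum_mem fun i _ => smul_mem_vN _ (P.mem i), ?_, ?_, ?_⟩
  · rw [star_sum]
    refine Finset.sum_congr rfl fun i _ => ?_
    rw [star_smul, (P.proj i).isSelfAdjoint.star_eq]
    rcases hs1 i with h | h <;> simp [h]
  · rw [Finset.sum_mul_sum, ← P.sum]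
    refine Finset.sum_congr rfl fun i _ => ?_
    rw [Finset.sum_eq_single i (fun j _ hij => ?_) (by simp)]
    · rw [smul_mul_smul_comm, (P.proj i).isIdempotentElem.eq]
      rcases hs1 i with h | h <;> simp [h]
    · rw [smul_mul_smul_comm, P.orth i j hij.symm, smul_zero]
  · have e1 : phi E u (∑ i, s i • P.e i) = ∑ i, s i • phi E u (P.e i) := by
      rw [phi_sum]
      simp [phi]
    rw [e1]
    refine hle.trans ((Finset.sum_le_sum (g := fun i => (T (phi E a (P.e i))).re +
      ((T (phi E y (P.e i) * phi E y (P.e i))).re / (2 * ε) + ε / 2 * (T (phi E u (P.e i))).re))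
      fun i _ => ?_).trans ?_)
    · rw [hs hu i]; exact hterm i
    · have s1 : ∑ i, (T (phi E a (P.e i))).re = (T (star a * a)).re := by
        rw [← Complex.re_sum, ← map_sum, ← phi_sum, P.sum, phi, mul_one,
          hE.trace_apply (mul_mem (star_mem haM) haM)]
      have s2 : ∑ i, (T (phi E u (P.e i))).re = 1 := by
        rw [← Complex.re_sum, ← map_sum, ← phi_sum, P.sum, hphi1, hT.one, Complex.one_re]
      have s3 : ∑ i, (T (phi E y (P.e i) * phi E y (P.e i))).re < ε ^ 2 := by
        simpa [energy] using hP
      rw [Finset.sum_add_distrib, Finset.sum_add_distrib, ← Finset.sum_div, ← Finset.mul_sum, s1,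
        s2, ← ha]
      have : (∑ i, (T (phi E y (P.e i) * phi E y (P.e i))).re) / (2 * ε) ≤ ε / 2 := by
        rw [div_le_iff₀ (by positivity)]
        nlinarith
      linarith

/-- Some symmetry `v ∈ A` almost realises `‖u - F u‖₂` as a distance between expectations. -/
theorem exists_symmetry_le [Nontrivial H] (hT : IsTrace M T) (hE : IsExp M A T E)
    (hF : IsExp M N T F)
    (hM : ∀ x ∈ M, (∀ y ∈ M, x * y = y * x) → ∃ c : ℂ, x = c • 1)
    (hcomm : ∀ a ∈ A, ∀ b ∈ A, a * b = b * a) (hmasa : ∀ x ∈ M, (∀ a ∈ A, x * a = a * x) → x ∈ A)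
    (hAN : ∀ a ∈ A, a ∈ N)
    (hN : ∀ u ∈ M, star u = u → u * u = 1 → (∀ a ∈ A, u * a * u ∈ A) → u ∈ N)
    {u : H →L[ℂ] H} (hu : u ∈ M) (hu1 : star u * u = 1) {ε : ℝ} (hε : 0 < ε) :
    ∃ v ∈ A, star v = v ∧ v * v = 1 ∧ (T (star (u - F u) * (u - F u))).re ≤
      (T (star (u * E (star u * v * u) * star u - E v) *
        (u * E (star u * v * u) * star u - E v))).re + ε := by
  obtain ⟨v, hv, hvs, hvv, hle⟩ := exists_symmetry hT hE hF hM hcomm hmasa hAN hN hu hu1 hε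
  refine ⟨v, hv, hvs, hvv, ?_⟩
  have hvM := hE.sub _ hv
  have hxM : star u * v * u ∈ M := mul_mem (mul_mem (star_mem hu) hvM) hu
  obtain ⟨c, hc⟩ : ∃ c, c = E (star u * v * u) := ⟨_, rfl⟩
  have hcA : c ∈ A := hc ▸ hE.mem _ hxM
  have hcM := hE.sub _ hcA
  have hcs : star c = c := by
    rw [hc, ← hE.star_apply hT hxM]; simp [hvs, mul_assoc]
  have hsu := star_mem hu
  have hcc : T (star u * v * u * c) = T (c * c) := by
    rw [← hE.trace_mul hxM hcA, ← hc]
  have h1 : T (u * c * star u * v) = T (c * c) := by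
    rw [← hcc, mul_assoc, hT.comm _ (mul_mem hu hcM) _ (mul_mem hsu hvM), mul_assoc, mul_assoc,
      mul_assoc]
  have h2 : T (v * (u * c * star u)) = T (c * c) := by
    rw [hT.comm _ hvM _ (mul_mem (mul_mem hu hcM) hsu), h1]
  have h3 : T (u * c * star u * (u * c * star u)) = T (c * c) := by
    have e : u * c * star u * (u * c * star u) = u * c * (star u * u) * c * star u := by
      noncomm_ring
    rw [e, hu1, mul_one, mul_assoc u, hT.comm _ (mul_mem hu (mul_mem hcM hcM)) _ hsu, ← mul_assoc,
      hu1, one_mul]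
  have h4 : T (star (u * c * star u - v) * (u * c * star u - v)) = 1 - T (c * c) := by
    have e : star (u * c * star u - v) * (u * c * star u - v) =
        u * c * star u * (u * c * star u) - u * c * star u * v - v * (u * c * star u) + v * v := by
      have : star (u * c * star u - v) = u * c * star u - v := by simp [hcs, hvs, mul_assoc]
      rw [this]; noncomm_ring
    rw [e, map_add, map_sub, map_sub, h1, h2, h3, hvv, hT.one]
    ring
  have h5 := congr(($(hF.norm_sub_sq hT hu)).re)
  rw [hu1, hT.one] at h5
  rw [phi, ← hc, hcs] at hle
  rw [hE.apply_mem hT hv, ← hc, h4, h5]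
  simp only [Complex.sub_re, Complex.one_re]
  linarith

end final

theorem exists_vonNeumannAlgebra {S : Set (H →L[ℂ] H)} (hstar : ∀ x ∈ S, star x ∈ S)
    (hS : S.centralizer.centralizer = S) : ∃ V : VonNeumannAlgebra H, ∀ x, x ∈ V ↔ x ∈ S := by
  have hS' : ∀ {x}, (∀ y ∈ S.centralizer, y * x = x * y) → x ∈ S := fun h => hS ▸ h
  have hcomm : ∀ {x}, x ∈ S → ∀ y ∈ S.centralizer, y * x = x * y := fun hx y hy => (hy _ hx).symm
  let V : VonNeumannAlgebra H :=
    { carrier := S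
      mul_mem' := fun {a b} ha hb => hS' fun y hy => by
        rw [← mul_assoc, hcomm ha y hy, mul_assoc, hcomm hb y hy, mul_assoc]
      one_mem' := hS' fun y _ => by simp
      add_mem' := fun {a b} ha hb => hS' fun y hy => by
        rw [mul_add, add_mul, hcomm ha y hy, hcomm hb y hy]
      zero_mem' := hS' fun y _ => by simp
      algebraMap_mem' := fun c => hS' fun y _ => (Algebra.commutes c y).symm
      star_mem' := fun {a} ha => hstar a ha
      centralizer_centralizer' := hS }
  exact ⟨V, fun _ => Iff.rfl⟩

theorem star_mem_centralizer {S : Set (H →L[ℂ] H)} (hS : ∀ x ∈ S, star x ∈ S) {x : H →L[ℂ] H}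
    (hx : x ∈ S.centralizer) : star x ∈ S.centralizer := fun y hy => by
  simpa using (congrArg star (hx _ (hS y hy))).symm

theorem exists_normAlg (S A : Set (H →L[ℂ] H)) :
    ∃ V : VonNeumannAlgebra H, ∀ x, x ∈ V ↔ x ∈ normAlg S A :=
  exists_vonNeumannAlgebra (fun _ hx => star_mem_centralizer (fun _ hy => star_mem_centralizer
    (fun z hz => hz.elim (fun h => Or.inr ⟨z, h, rfl⟩)
      fun ⟨w, hw, e⟩ => Or.inl (by rwa [← e, star_star])) hy) hx)
    (Set.centralizer_centralizer_centralizer _)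

theorem exists_linearMap {F : Type*} [AddCommGroup F] [Module ℂ F] (f : (H →L[ℂ] H) → F)
    (hadd : ∀ x ∈ M, ∀ y ∈ M, f (x + y) = f x + f y)
    (hsmul : ∀ (c : ℂ), ∀ x ∈ M, f (c • x) = c • f x) :
    ∃ g : (H →L[ℂ] H) →ₗ[ℂ] F, ∀ x ∈ M, g x = f x := by
  let S : Submodule ℂ (H →L[ℂ] H) :=
    { carrier := {x | x ∈ M}
      add_mem' := fun {a b} (ha : a ∈ M) (hb : b ∈ M) => (add_mem ha hb : a + b ∈ M)
      zero_mem' := zero_mem M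
      smul_mem' := fun c _ hx => smul_mem_vN c hx }
  let f₀ : S →ₗ[ℂ] F :=
    { toFun := fun x => f x
      map_add' := fun x y => hadd x x.2 y y.2
      map_smul' := fun c x => hsmul c x x.2 }
  obtain ⟨g, hg⟩ := f₀.exists_extend
  exact ⟨g, fun x hx => LinearMap.congr_fun hg ⟨x, hx⟩⟩

theorem exists_isExp (hT : IsTrace M T) (hB : ∀ x ∈ B, x ∈ M) (f : (H →L[ℂ] H) → H →L[ℂ] H)
    (hf : ∀ x ∈ M, f x ∈ B) (horth : ∀ x ∈ M, ∀ b ∈ B, T ((x - f x) * b) = 0) :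
    ∃ E, IsExp M B T E ∧ ∀ x ∈ M, E x = f x := by
  have key : ∀ d ∈ B, (∀ b ∈ B, T (d * b) = 0) → d = 0 := fun d hd h =>
    hT.faithful d (hB d hd) (by
      rw [hT.comm _ (star_mem (hB d hd)) _ (hB d hd)]
      exact h _ (star_mem hd))
  obtain ⟨E, hE⟩ := exists_linearMap (M := M) f
    (fun x hx y hy => by
      have hxy := add_mem hx hy
      refine sub_eq_zero.1 (key _ (sub_mem (hf _ hxy) (add_mem (hf x hx) (hf y hy))) fun b hb => ?_)
      have e : (f (x + y) - (f x + f y)) * b =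
          (x - f x) * b + (y - f y) * b - (x + y - f (x + y)) * b := by noncomm_ring
      rw [e, map_sub, map_add, horth x hx b hb, horth y hy b hb, horth _ hxy b hb]
      simp)
    (fun c x hx => by
      have hcx := smul_mem_vN c hx
      refine sub_eq_zero.1 (key _ (sub_mem (hf _ hcx) (smul_mem_vN c (hf x hx))) fun b hb => ?_)
      have e : (f (c • x) - c • f x) * b = c • ((x - f x) * b) - (c • x - f (c • x)) * b := by
        simp only [sub_mul, smul_sub, smul_mul_assoc]
        abel
      rw [e, map_sub, map_smul, horth x hx b hb, horth _ hcx b hb]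
      simp)
  exact ⟨E, ⟨hB, fun x hx => by rw [hE x hx]; exact hf x hx,
    fun x hx b hb => by rw [hE x hx]; exact horth x hx b hb⟩, hE⟩

theorem IsTrace.re_sub_le (hT : IsTrace M T) {x y : H →L[ℂ] H} (hx : x ∈ M) (hy : y ∈ M) :
    (T (star (x - y) * (x - y))).re ≤ 2 * (T (star x * x)).re + 2 * (T (star y * y)).re := by
  have h := (Complex.nonneg_iff.1 (hT.nonneg_star (x + y) (add_mem hx hy))).1
  have e : star (x - y) * (x - y) =
      (star x * x + star x * x) + (star y * y + star y * y) - star (x + y) * (x + y) := by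
    simp only [star_sub, star_add]
    noncomm_ring
  rw [e]
  simp only [map_sub, map_add, Complex.sub_re, Complex.add_re] at h ⊢
  linarith

/-- The differences of conjugated expectations are bounded in `‖·‖₂` on the unit ball. -/
theorem IsExp.re_conj_sub_le [Nontrivial H] (hT : IsTrace M T) (hE : IsExp M A T E)
    {u x : H →L[ℂ] H} (hu : u ∈ M) (hu1 : star u * u = 1) (hu2 : u * star u = 1) (hx : x ∈ M)
    (hx1 : ‖x‖ ≤ 1) :
    (T (star (u * E (star u * x * u) * star u - E x) *
      (u * E (star u * x * u) * star u - E x))).re ≤ 4 := by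
  have hbd : (T (star x * x)).re ≤ 1 := by
    have h : star x * x ≤ 1 := by
      refine (star_mul_self_le_norm x).trans ?_
      have : ((‖x‖ ^ 2 : ℝ) : ℂ) ≤ 1 := by exact_mod_cast pow_le_one₀ (norm_nonneg x) hx1
      have h2 := smul_nonneg (sub_nonneg.2 this) (zero_le_one (α := H →L[ℂ] H))
      rwa [sub_smul, one_smul, sub_nonneg] at h2
    simpa [hT.one] using hT.re_mono (mul_mem (star_mem hx) hx) (one_mem M) h
  have hxu : star u * x * u ∈ M := mul_mem (mul_mem (star_mem hu) hx) hu
  obtain ⟨c, hc⟩ : ∃ c, c = E (star u * x * u) := ⟨_, rfl⟩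
  have hcM : c ∈ M := hE.sub _ (hc ▸ hE.mem _ hxu)
  have h1 : (T (star (u * c * star u) * (u * c * star u))).re ≤ 1 := by
    have e : star (u * c * star u) * (u * c * star u) = u * (star c * c * star u) := by
      simp only [star_mul, star_star]
      calc u * (star c * star u) * (u * c * star u)
          = u * star c * (star u * u) * c * star u := by noncomm_ring
        _ = _ := by rw [hu1]; noncomm_ring
    rw [e, hT.comm _ hu _ (mul_mem (mul_mem (star_mem hcM) hcM) (star_mem hu)), mul_assoc, hu1,
      mul_one, hc]
    refine (hE.re_trace_le hT hxu).trans ?_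
    have e2 : star (star u * x * u) * (star u * x * u) = star u * (star x * x * u) := by
      simp only [star_mul, star_star]
      calc star u * (star x * u) * (star u * x * u)
          = star u * star x * (u * star u) * x * u := by noncomm_ring
        _ = _ := by rw [hu2]; noncomm_ring
    rw [e2, hT.comm _ (star_mem hu) _ (mul_mem (mul_mem (star_mem hx) hx) hu), mul_assoc, hu2,
      mul_one]
    exact hbd
  rw [← hc]
  refine (hT.re_sub_le (mul_mem (mul_mem hu hcM) (star_mem hu)) (hE.sub _ (hE.mem x hx))).trans ?_
  linarith [hE.re_trace_le hT hx]

end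

end SinclairSmith

open SinclairSmith

/-- **generalized Sinclair–Smith inequality.** For a MASA `A` in a II₁ factor
`M` with `N := N_M(A)''`, every unitary `u ∈ M` satisfies
`‖E_{uAu*} − E_A‖_{∞,2} ≥ ‖u − E_N(u)‖₂`. -/
theorem generalized_SinclairSmith_inequality
    {H : Type*} [NormedAddCommGroup H] [InnerProductSpace ℂ H] [CompleteSpace H]
    (M A : Set (H →L[ℂ] H)) (τ : (H →L[ℂ] H) → ℂ)
    (EA EN : (H →L[ℂ] H) → (H →L[ℂ] H))
    (hM : IsII1Factor M τ) (hA : IsMasa M A)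
    (hEA : IsCondExp M A τ EA)
    (hEN : IsCondExp M (normAlg M A) τ EN) :
    ∀ u ∈ M, IsUnitary u →
      norm2 τ (u - EN u) ≤ normInfty2 M τ (fun x => conjCondExp EA u x - EA x) := by
  intro u hu ⟨hu1, hu2⟩
  have htr := hM.trace
  obtain ⟨hAsub, hAstar, hAmasa⟩ := hA
  have hAiff : ∀ x, x ∈ A ↔ x ∈ M ∧ ∀ a ∈ A, x * a = a * x := fun x =>
    ⟨fun h => by rw [← hAmasa] at h; exact h, fun h => by rw [← hAmasa]; exact h⟩
  have hAcomm : ∀ a ∈ A, ∀ b ∈ A, a * b = b * a := fun a ha => ((hAiff a).1 ha).2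
  have : Nontrivial H := by
    rcases subsingleton_or_nontrivial H with h | h
    · exfalso
      have h0 := htr.map_smul 0 1 hM.vna.one_mem
      rw [Subsingleton.elim ((0 : ℂ) • (1 : H →L[ℂ] H)) 1, htr.map_one] at h0
      simp at h0
    · exact h
  have hMdc := hM.vna.double_commutant
  obtain ⟨VM, hVM⟩ := exists_vonNeumannAlgebra hM.vna.star_mem hMdc
  obtain ⟨VA, hVA⟩ := exists_vonNeumannAlgebra hAstar (Set.Subset.antisymm (fun x hx =>
    (hAiff x).2 ⟨hMdc ▸ Set.centralizer_subset (Set.centralizer_subset hAsub) hx, fun a ha =>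
      (hx a (fun b hb => hAcomm b hb a ha)).symm⟩) Set.subset_centralizer_centralizer)
  obtain ⟨VN, hVN⟩ := exists_normAlg M A
  have hnormalizer : normalizerSet M A ⊆ normAlg M A := fun x hx =>
    Set.subset_centralizer_centralizer (Or.inl hx)
  have hNM : normAlg M A ⊆ M := by
    have h : normalizerSet M A ∪ star '' normalizerSet M A ⊆ M := by
      rintro _ (h | ⟨w, h, rfl⟩)
      · exact h.1
      · exact hM.vna.star_mem _ h.1
    exact (Set.centralizer_subset (Set.centralizer_subset h)).trans hMdc.subset
  have hsymm : ∀ w ∈ M, star w = w → w * w = 1 → (∀ a ∈ A, w * a * w ∈ A) → w ∈ normAlg M A := by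
    refine fun w hw hs hww hwA => hnormalizer ⟨hw, ⟨by rw [hs, hww], by rw [hs, hww]⟩, ?_⟩
    refine Set.Subset.antisymm ?_ fun a ha => ⟨w * a * w, hwA a ha, ?_⟩
    · rintro _ ⟨a, ha, rfl⟩
      simpa only [hs] using hwA a ha
    · simp only [hs]
      calc w * (w * a * w) * w = (w * w) * a * (w * w) := by noncomm_ring
        _ = a := by rw [hww]; simp
  have hVAN : ∀ a ∈ VA, a ∈ VN := fun a ha => by
    refine le_of_projections (fun p hp hpp => ?_) ha
    have hpA := (hVA p).1 hp
    have hs : star p = p := hpp.isSelfAdjoint.star_eq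
    have hpi : p * p = p := hpp.isIdempotentElem.eq
    have hww : ((2 : ℂ) • p - 1) * ((2 : ℂ) • p - 1) = 1 := by
      simp only [sub_mul, mul_sub, smul_mul_assoc, mul_smul_comm, hpi, mul_one, one_mul]
      module
    have hwA : (2 : ℂ) • p - 1 ∈ VA := sub_mem (smul_mem_vN _ hp) (one_mem VA)
    have hwN : (2 : ℂ) • p - 1 ∈ VN := (hVN _).2 (hsymm _ (hAsub ((hVA _).1 hwA))
      (by simp [star_smul, hs]) hww fun a ha => (hVA _).1
        (mul_mem (mul_mem hwA ((hVA a).2 ha)) hwA))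
    have e : p = (2⁻¹ : ℂ) • (((2 : ℂ) • p - 1) + 1) := by
      rw [sub_add_cancel, smul_smul]
      norm_num
    rw [e]
    exact smul_mem_vN _ (add_mem hwN (one_mem VN))
  obtain ⟨T, hTτ⟩ := exists_linearMap (M := VM) τ
    (fun x hx y hy => htr.map_add x ((hVM x).1 hx) y ((hVM y).1 hy))
    (fun c x hx => htr.map_smul c x ((hVM x).1 hx))
  have hT : IsTrace VM T :=
    { one := by rw [hTτ 1 (one_mem VM), htr.map_one]
      nonneg_star := fun x hx => by
        rw [hTτ _ (mul_mem (star_mem hx) hx)]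
        exact htr.nonneg x ((hVM x).1 hx)
      comm := fun x hx y hy => by
        rw [hTτ _ (mul_mem hx hy), hTτ _ (mul_mem hy hx)]
        exact htr.tracial x ((hVM x).1 hx) y ((hVM y).1 hy)
      faithful := fun x hx h => by
        rw [hTτ _ (mul_mem (star_mem hx) hx)] at h
        exact htr.faithful x ((hVM x).1 hx) h }
  have hexp : ∀ (B : Set (H →L[ℂ] H)) (VB : VonNeumannAlgebra H) (f : (H →L[ℂ] H) → H →L[ℂ] H),
      (∀ x, x ∈ VB ↔ x ∈ B) → B ⊆ M → IsCondExp M B τ f →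
      ∃ E, IsExp VM VB T E ∧ ∀ x ∈ VM, E x = f x := by
    intro B VB f hVB hBM ⟨h1, h2⟩
    have hsub : ∀ x ∈ VB, x ∈ VM := fun x hx => (hVM x).2 (hBM ((hVB x).1 hx))
    have hf : ∀ x ∈ VM, f x ∈ VB := fun x hx => (hVB _).2 (h1 x ((hVM x).1 hx))
    refine exists_isExp hT hsub f hf fun x hx b hb => ?_
    rw [hTτ _ (mul_mem (sub_mem hx (hsub _ (hf x hx))) (hsub b hb))]
    exact h2 x ((hVM x).1 hx) b ((hVB b).1 hb)
  obtain ⟨E, hE, hEf⟩ := hexp A VA EA hVA hAsub hEA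
  obtain ⟨F, hF, hFf⟩ := hexp _ VN EN hVN hNM hEN
  have huV := (hVM u).2 hu
  have hconj : ∀ x ∈ M, norm2 τ (conjCondExp EA u x - EA x) =
      √(T (star (u * E (star u * x * u) * star u - E x) *
        (u * E (star u * x * u) * star u - E x))).re := by
    intro x hx
    have hxV := (hVM x).2 hx
    have hxu : star u * x * u ∈ VM := mul_mem (mul_mem (star_mem huV) hxV) huV
    have hd : u * E (star u * x * u) * star u - E x ∈ VM :=
      sub_mem (mul_mem (mul_mem huV (hE.sub _ (hE.mem _ hxu))) (star_mem huV))
        (hE.sub _ (hE.mem _ hxV))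
    rw [hTτ _ (mul_mem (star_mem hd) hd), hEf _ hxu, hEf _ hxV]
    rfl
  obtain ⟨s, hs⟩ : ∃ s, s = normInfty2 M τ (fun x => conjCondExp EA u x - EA x) := ⟨_, rfl⟩
  have hs0 : 0 ≤ s := by
    rw [hs]
    refine Real.sSup_nonneg ?_
    rintro _ ⟨x, -, -, rfl⟩
    exact Real.sqrt_nonneg _
  have hbdd : BddAbove {r : ℝ | ∃ x ∈ M, ‖x‖ ≤ 1 ∧ r = norm2 τ (conjCondExp EA u x - EA x)} := by
    refine ⟨√4, ?_⟩
    rintro _ ⟨x, hx, hx1, rfl⟩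
    rw [hconj x hx]
    exact Real.sqrt_le_sqrt (hE.re_conj_sub_le hT huV hu1 hu2 ((hVM x).2 hx) hx1)
  have hd : u - F u ∈ VM := sub_mem huV (hF.sub _ (hF.mem _ huV))
  have hnorm : norm2 τ (u - EN u) = √(T (star (u - F u) * (u - F u))).re := by
    rw [hTτ _ (mul_mem (star_mem hd) hd), hFf u huV]
    rfl
  rw [← hs, hnorm]
  refine Real.sqrt_le_iff.2 ⟨hs0, le_of_forall_pos_le_add fun ε hε => ?_⟩
  obtain ⟨v, hvA, hvs, hvv, hle⟩ := exists_symmetry_le hT hE hF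
    (fun x hx h => hM.factor x ((hVM x).1 hx) fun y hy => h y ((hVM y).2 hy))
    (fun a ha b hb => hAcomm a ((hVA a).1 ha) b ((hVA b).1 hb))
    (fun x hx h => (hVA x).2 ((hAiff x).2 ⟨(hVM x).1 hx, fun a ha => h a ((hVA a).2 ha)⟩))
    hVAN (fun w hw hws hww h => (hVN w).2 (hsymm w ((hVM w).1 hw) hws hww fun a ha =>
      (hVA _).1 (h a ((hVA a).2 ha)))) huV hu1 hε
  refine hle.trans (add_le_add_left ?_ ε)
  have hvM : v ∈ M := hAsub ((hVA v).1 hvA)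
  have hv1 : ‖v‖ ≤ 1 := by
    have h := CStarRing.norm_star_mul_self (x := v)
    rw [hvs, hvv, norm_one] at h
    nlinarith [norm_nonneg v]
  have hvs' : norm2 τ (conjCondExp EA u v - EA v) ≤ s := by
    rw [hs]
    exact le_csSup hbdd ⟨v, hvM, hv1, rfl⟩
  rw [hconj v hvM] at hvs'
  exact (Real.sqrt_le_left hs0).1 hvs'
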